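/- arXiv:2306.00126 — 2 statements merged into one kernel-verified Lean document; each statement's English description precedes it below -/
import Mathlib

section
/- Canonical path length bound for Bayesian CART: Let 𝓔 be the canonical path ensemble for Bayesian CART built from the transition map 𝒢, and let |T_{𝒯,𝒯'}| denote the length of the path between 𝒯, 𝒯' ∈ 𝕋_L. Then ℓ(𝓔) = max_{𝒯,𝒯' ∈ 𝕋_L} |T_{𝒯,𝒯'}| ≤ 2^{L+1}. -/
open Finset MeasureTheory Real
open scoped BigOperators NNReal ENNReal

noncomputable section

namespace BayesCART

/-! ## Trees

Nodes of the dyadic (Haar wavelet) tree are encoded by the index `j = 2^l + k`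
(the root `ψ_{-1,0}` is `j = 0`, and `ψ_{l,k} ↦ 2^l + k` for `l ≥ 0`, `0 ≤ k < 2^l`).
The children of a node `j ≥ 1` are `2j` and `2j+1`, the unique child of the root `0`
is `1`, and the parent of `j ≥ 1` is `j / 2`.  A tree is identified with the finite
set `S` of its internal nodes, which must contain the root and be ancestor-closed. -/

/-- `S` is the internal-node set of a tree all of whose internal nodes have depth `< L`. -/
def IsTree (L : ℕ) (S : Finset ℕ) : Prop :=
  0 ∈ S ∧ (∀ j ∈ S, 1 ≤ j → j / 2 ∈ S) ∧ ∀ j ∈ S, j < 2 ^ L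

instance (L : ℕ) : DecidablePred (IsTree L) := fun _ => by unfold IsTree; infer_instance

/-- The (finite) collection `𝕋_L` of all trees with internal nodes of depth `< L`. -/
def trees (L : ℕ) : Finset (Finset ℕ) :=
  (Finset.range (2 ^ L)).powerset.filter (IsTree L)

/-- The external (leaf) nodes `𝒯_ext` of the tree with internal nodes `S`. -/
def extSet (S : Finset ℕ) : Finset ℕ :=
  ((S.image fun j => 2 * j) ∪ S.image fun j => 2 * j + 1).filter fun j => j ∉ S

/-! ## The Haar design -/

/-- The Haar mother wavelet `ψ = 1_{(0,1/2]} − 1_{(1/2,1]}`. -/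
def haarMother (x : ℝ) : ℝ :=
  if 0 < x ∧ x ≤ 1 / 2 then 1 else if 1 / 2 < x ∧ x ≤ 1 then -1 else 0

/-- Entry `i` of column `j` of the Haar design matrix with `n` observations at the
design points `x_i = (i+1)/n`: column `j = 0` is `ψ_{-1,0} ≡ 1`, and column
`j = 2^l + k ≥ 1` is `ψ_{lk}(x) = 2^{l/2} ψ(2^l x − k)`. -/
def haarCol (n j i : ℕ) : ℝ :=
  if j = 0 then 1
  else
    (2 : ℝ) ^ ((Nat.log 2 j : ℝ) / 2) *
      haarMother ((2 : ℝ) ^ (Nat.log 2 j) * ((i + 1 : ℝ) / n) - ((j - 2 ^ Nat.log 2 j : ℕ) : ℝ))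

/-- The inner product `X_j' Y` of the `j`-th design column with a vector `Y ∈ ℝⁿ`. -/
def colDot (n : ℕ) (Y : Fin n → ℝ) (j : ℕ) : ℝ := ∑ i : Fin n, haarCol n j i.val * Y i

/-- The vector `X β* = Σ_{j ∈ B} β*_j ψ_j` of values of `f₀` at the design points. -/
def signalVec (n : ℕ) (β : ℕ → ℝ) (B : Finset ℕ) : Fin n → ℝ :=
  fun i => ∑ j ∈ B, β j * haarCol n j i.val

/-- The response `Y = X β* + ε`. -/
def Yvec (n : ℕ) (β : ℕ → ℝ) (B : Finset ℕ) (ε : Fin n → ℝ) : Fin n → ℝ :=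
  fun i => signalVec n β B i + ε i

/-- The standard Gaussian measure of `ε = (ε_1, …, ε_n) ~ N(0, I_n)`. -/
def gauss (n : ℕ) : Measure (Fin n → ℝ) :=
  Measure.pi fun _ => ProbabilityTheory.gaussianReal 0 1

/-! ## Prior and posterior -/

/-- The split probability `p_{lk} = n^{-c}`. -/
def splitP (n : ℕ) (c : ℝ) : ℝ := (n : ℝ) ^ (-c)

/-- Unnormalized Galton–Watson tree prior `Π(𝒯) ∝ ∏_{int} p ∏_{ext} (1 − p)`
with constant split probability `p`. -/
def priorWt (p : ℝ) (S : Finset ℕ) : ℝ := p ^ S.card * (1 - p) ^ (extSet S).card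

/-- The marginal likelihood
`N_Y(𝒯) = (2π)^{-n/2} (1+n)^{-|𝒯_ext|/2} exp{−½ Y'[I − X_𝒯 Σ_𝒯 X_𝒯'] Y}`;
for the orthogonal Haar design (`X'X = nI`) with `Σ_𝒯 = (n/(n+1))(X_𝒯'X_𝒯)^{-1}`,
`Y' X_𝒯 Σ_𝒯 X_𝒯' Y = (n+1)^{-1} Σ_{j ∈ 𝒯_int} (X_j'Y)²`. -/
def margLik (n : ℕ) (Y : Fin n → ℝ) (S : Finset ℕ) : ℝ :=
  (2 * π) ^ (-(n : ℝ) / 2) * ((1 + n : ℝ) ^ (-((extSet S).card : ℝ) / 2)) *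
    Real.exp (-(1 / 2) * ((∑ i, Y i ^ 2) - (1 / ((n : ℝ) + 1)) * ∑ j ∈ S, colDot n Y j ^ 2))

/-- Unnormalized posterior weight `Π(𝒯) N_Y(𝒯)`. -/
def postWt (n : ℕ) (p : ℝ) (Y : Fin n → ℝ) (S : Finset ℕ) : ℝ :=
  priorWt p S * margLik n Y S

/-- Posterior probability `Π(𝒯 ∣ Y)` of a single tree in `𝕋_L`. -/
def post (L n : ℕ) (p : ℝ) (Y : Fin n → ℝ) (S : Finset ℕ) : ℝ :=
  postWt n p Y S / ∑ T ∈ trees L, postWt n p Y T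

/-- Posterior probability of a family of trees. -/
def postSet (L n : ℕ) (p : ℝ) (Y : Fin n → ℝ) (A : Finset (Finset ℕ)) : ℝ :=
  ∑ T ∈ A ∩ trees L, post L n p Y T

/-! ## Assumption 1 -/

/-- Assumption 1: `f₀ = Σ_{(l,k) ∈ ℬ} β*_{lk} ψ_{lk}` with all signal
coefficients of magnitude in `(A log n / √n, C)`, and `𝒯* ∈ 𝕋_L` is the smallest
tree containing `ℬ` among its internal nodes. -/
structure Assumption1 (L n : ℕ) (A C : ℝ) (β : ℕ → ℝ) (B Sstar : Finset ℕ) : Prop where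
  B_depth : ∀ j ∈ B, j < 2 ^ L
  signal_low : ∀ j ∈ B, A * Real.log n / Real.sqrt n < |β j|
  signal_high : ∀ j ∈ B, |β j| < C
  support : ∀ j, j ∉ B → β j = 0
  Sstar_tree : Sstar ∈ trees L
  Sstar_contains : B ⊆ Sstar
  Sstar_min : ∀ T ∈ trees L, B ⊆ T → Sstar ⊆ T

/-! ## The Bayesian CART proposal -/

/-- GROW candidates: external nodes of depth `< L`. -/
def growCands (L : ℕ) (S : Finset ℕ) : Finset ℕ := (extSet S).filter fun j => j < 2 ^ L

/-- PRUNE candidates: pre-terminal internal nodes (no children internal), root excluded. -/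
def pruneCands (S : Finset ℕ) : Finset ℕ :=
  S.filter fun j => j ≠ 0 ∧ 2 * j ∉ S ∧ 2 * j + 1 ∉ S

/-- The GROW/PRUNE proposal kernel of (dyadic) Bayesian CART: GROW and PRUNE are
chosen with probability `1/2` each (with forced moves at the null and the full tree),
a GROW splits a uniformly chosen external node, and a PRUNE collapses a uniformly
chosen pre-terminal node. -/
def bcartProp (L : ℕ) (S S' : Finset ℕ) : ℝ :=
  (if (pruneCands S).Nonempty then (1 : ℝ) / 2 else 1) *
      (((growCands L S).filter fun j => insert j S = S').card / (growCands L S).card)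
    + (if (growCands L S).Nonempty then (1 : ℝ) / 2 else 1) *
      (((pruneCands S).filter fun j => S.erase j = S').card / (pruneCands S).card)

/-! ## Metropolis–Hastings machinery -/

/-- The Metropolis–Hastings transition matrix on `𝕋_L` with target `π₀` and proposal `q`. -/
def mhTrans (L : ℕ) (π₀ : Finset ℕ → ℝ) (q : Finset ℕ → Finset ℕ → ℝ)
    (S S' : Finset ℕ) : ℝ :=
  if S' = S then
    1 - ∑ T ∈ (trees L).erase S, q S T * min 1 ((π₀ T * q T S) / (π₀ S * q S T))
  else q S S' * min 1 ((π₀ S' * q S' S) / (π₀ S * q S S'))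

/-- The lazy modification `(P + I)/2` of a transition matrix. -/
def lazy (P : Finset ℕ → Finset ℕ → ℝ) (S S' : Finset ℕ) : ℝ :=
  (1 / 2) * P S S' + if S' = S then 1 / 2 else 0

/-- `t`-step transition probabilities over the state space `𝕋_L`. -/
def iterP (L : ℕ) (P : Finset ℕ → Finset ℕ → ℝ) : ℕ → Finset ℕ → Finset ℕ → ℝ
  | 0, S, S' => if S' = S then 1 else 0
  | t + 1, S, S' => ∑ T ∈ trees L, iterP L P t S T * P T S'

/-- Total variation distance `‖P^t(S, ·) − Π(· ∣ Y)‖_TV` between the chain at time `t`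
started at `S` and the posterior. -/
def tvDist (L n : ℕ) (p : ℝ) (Y : Fin n → ℝ) (P : Finset ℕ → Finset ℕ → ℝ)
    (t : ℕ) (S : Finset ℕ) : ℝ :=
  (1 / 2) * ∑ T ∈ trees L, |iterP L P t S T - post L n p Y T|

/-- The `ε`-mixing time `τ_ε = max_{𝒯 ∈ 𝕋_L} min{t : Δ_𝒯(t') ≤ ε for all t' ≥ t}`. -/
def mixTime (L n : ℕ) (p : ℝ) (Y : Fin n → ℝ) (P : Finset ℕ → Finset ℕ → ℝ) (ε : ℝ) : ℕ :=
  sInf {t | ∀ t' ≥ t, ∀ S ∈ trees L, tvDist L n p Y P t' S ≤ ε}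

/-- The (non-lazy) Bayesian CART Metropolis–Hastings transition matrix. -/
def bcartP (L n : ℕ) (c : ℝ) (Y : Fin n → ℝ) : Finset ℕ → Finset ℕ → ℝ :=
  mhTrans L (post L n (splitP n c) Y) (bcartProp L)

end BayesCART
namespace BayesCART

/-! ## Twigs and the Twiggy proposal -/

/-- `isAnc a b`: node `a` is a strict ancestor of node `b`. -/
def isAnc (a b : ℕ) : Prop := ∃ t ∈ Finset.Icc 1 b, b / 2 ^ t = a

instance (a b : ℕ) : Decidable (isAnc a b) := by unfold isAnc; infer_instance

/-- All nodes on the ancestral path from node `j` up to the root (including `j`). -/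
def ancPath (j : ℕ) : Finset ℕ := (Finset.range (j + 1)).image fun t => j / 2 ^ t

/-- The tree obtained from `S` by growing, from the closest external node,
the twig ending at the node `j`: the smallest tree containing `S ∪ {j}`. -/
def growTwig (S : Finset ℕ) (j : ℕ) : Finset ℕ := S ∪ ancPath j

/-- The internal descendants of `j` inside the tree `S`. -/
def descIn (S : Finset ℕ) (j : ℕ) : Finset ℕ := S.filter fun m => isAnc j m

/-- Twiggy PRUNE candidates: non-root internal nodes whose internal descendants
form a twig (a chain in the ancestry order). -/
def twigPruneCands (S : Finset ℕ) : Finset ℕ :=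
  S.filter fun j => j ≠ 0 ∧
    ∀ a ∈ descIn S j, ∀ b ∈ descIn S j, a = b ∨ isAnc a b ∨ isAnc b a

/-- The tree obtained by the Twiggy PRUNE at `j`: remove `j` and all of its descendants. -/
def pruneTwig (S : Finset ℕ) (j : ℕ) : Finset ℕ := S \ insert j (descIn S j)

/-- Nodes of layer (depth) `l` missing from `S`. -/
def layerNodes (S : Finset ℕ) (l : ℕ) : Finset ℕ :=
  (Finset.Ico (2 ^ l) (2 ^ (l + 1))).filter fun j => j ∉ S

/-- Probability `d_{l} = D^{-l} / Σ_{l' ∈ E} D^{-l'}` of picking layer `l` among the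
eligible layers. -/
def layerWt (D : ℝ) (L : ℕ) (S : Finset ℕ) (l : ℕ) : ℝ :=
  D ^ (-(l : ℝ)) /
    ∑ l' ∈ (Finset.range L).filter (fun l' => (layerNodes S l').Nonempty), D ^ (-(l' : ℝ))

/-- The Twiggy Bayesian CART proposal kernel: GROW picks a layer with probability
`∝ D^{-l}` then a missing node uniformly within the layer and attaches the whole twig
to it; PRUNE removes a uniformly chosen twig. -/
def twiggyProp (L : ℕ) (D : ℝ) (S S' : Finset ℕ) : ℝ :=
  (if (twigPruneCands S).Nonempty then (1 : ℝ) / 2 else 1) *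
      ∑ l ∈ Finset.range L, layerWt D L S l *
        (((layerNodes S l).filter fun j => growTwig S j = S').card / (layerNodes S l).card)
    + (if ∃ l ∈ Finset.range L, (layerNodes S l).Nonempty then (1 : ℝ) / 2 else 1) *
      (((twigPruneCands S).filter fun j => pruneTwig S j = S').card / (twigPruneCands S).card)

/-- The (non-lazy) Twiggy Bayesian CART Metropolis–Hastings transition matrix. -/
def twiggyP (L n : ℕ) (c D : ℝ) (Y : Fin n → ℝ) : Finset ℕ → Finset ℕ → ℝ :=
  mhTrans L (post L n (splitP n c) Y) (twiggyProp L D)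

/-! ## Locally informed (LIT-MH) proposals -/

/-- GROW neighborhood `𝒩_g(𝒯)` of Bayesian CART: one extra internal node. -/
def bNg (L : ℕ) (S : Finset ℕ) : Finset (Finset ℕ) :=
  (growCands L S).image fun j => insert j S

/-- PRUNE neighborhood `𝒩_p(𝒯)` of Bayesian CART: one internal node removed. -/
def bNp (S : Finset ℕ) : Finset (Finset ℕ) := (pruneCands S).image fun j => S.erase j

/-- GROW neighborhood of Twiggy Bayesian CART: one extra twig. -/
def tNg (L : ℕ) (S : Finset ℕ) : Finset (Finset ℕ) :=
  (((Finset.range (2 ^ L)).filter fun j => j ∉ S)).image fun j => growTwig S j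

/-- PRUNE neighborhood of Twiggy Bayesian CART: one twig removed. -/
def tNp (S : Finset ℕ) : Finset (Finset ℕ) := (twigPruneCands S).image fun j => pruneTwig S j

/-- The posterior ratio `B(𝒯, 𝒯̃) = Π(𝒯̃|Y)/Π(𝒯|Y)`. -/
def postRatio (L n : ℕ) (c : ℝ) (Y : Fin n → ℝ) (S S' : Finset ℕ) : ℝ :=
  post L n (splitP n c) Y S' / post L n (splitP n c) Y S

/-- Informed GROW weight `w_g(𝒯̃|𝒯) = min{Π(𝒯̃|Y)/Π(𝒯|Y), n^{(A² log n)/8}}`. -/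
def wg (L n : ℕ) (c A : ℝ) (Y : Fin n → ℝ) (S S' : Finset ℕ) : ℝ :=
  min (postRatio L n c Y S S') ((n : ℝ) ^ ((A ^ 2 * Real.log n) / 8))

/-- Informed PRUNE weight `w_p(𝒯̃|𝒯) = max{1, min{Π(𝒯̃|Y)/Π(𝒯|Y), n^{c−3/2}}}`. -/
def wp (L n : ℕ) (c : ℝ) (Y : Fin n → ℝ) (S S' : Finset ℕ) : ℝ :=
  max 1 (min (postRatio L n c Y S S') ((n : ℝ) ^ (c - 3 / 2)))

/-- Normalizing constant `Z_g(𝒯)` of the informed GROW proposal. -/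
def Zg (L n : ℕ) (c A : ℝ) (Y : Fin n → ℝ) (Ng : Finset ℕ → Finset (Finset ℕ))
    (S : Finset ℕ) : ℝ := ∑ T ∈ Ng S, wg L n c A Y S T

/-- Normalizing constant `Z_p(𝒯)` of the informed PRUNE proposal. -/
def Zp (L n : ℕ) (c : ℝ) (Y : Fin n → ℝ) (Np : Finset ℕ → Finset (Finset ℕ))
    (S : Finset ℕ) : ℝ := ∑ T ∈ Np S, wp L n c Y S T

/-- The locally informed (LIT-MH) proposal with neighborhoods `Ng`, `Np`. -/
def infProp (L n : ℕ) (c A : ℝ) (Y : Fin n → ℝ)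
    (Ng Np : Finset ℕ → Finset (Finset ℕ)) (S S' : Finset ℕ) : ℝ :=
  (1 / 2) * (if S' ∈ Ng S then wg L n c A Y S S' / Zg L n c A Y Ng S else 0)
    + (1 / 2) * (if S' ∈ Np S then wp L n c Y S S' / Zp L n c Y Np S else 0)

/-- The informed Bayesian CART Metropolis–Hastings transition matrix. -/
def infBcartP (L n : ℕ) (c A : ℝ) (Y : Fin n → ℝ) : Finset ℕ → Finset ℕ → ℝ :=
  mhTrans L (post L n (splitP n c) Y) (infProp L n c A Y (bNg L) bNp)

/-- The informed Twiggy Bayesian CART Metropolis–Hastings transition matrix. -/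
def infTwiggyP (L n : ℕ) (c A : ℝ) (Y : Fin n → ℝ) : Finset ℕ → Finset ℕ → ℝ :=
  mhTrans L (post L n (splitP n c) Y) (infProp L n c A Y (tNg L) tNp)

/-! ## Drift functions -/

/-- The first drift function
`V₁(𝒯) = exp{(2^L (C+2)² (n+1))^{-1} · Y'(I − P_𝒯/n)Y}`, where
`Y' P_𝒯 Y = Σ_{j ∈ 𝒯_int} (X_j'Y)²` for the orthogonal Haar design. -/
def V1 (L n : ℕ) (C : ℝ) (Y : Fin n → ℝ) (S : Finset ℕ) : ℝ :=
  Real.exp ((1 / (2 ^ L * (C + 2) ^ 2 * ((n : ℝ) + 1))) *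
    ((∑ i, Y i ^ 2) - (1 / (n : ℝ)) * ∑ j ∈ S, colDot n Y j ^ 2))

/-- The second drift function
`V₂(𝒯) = exp{2^{-L}(|𝒯_int ∖ 𝒯*_int| + min(|𝒯*_int ∖ 𝒯_int|,1)·(2^L − |𝒯_int ∪ 𝒯*_int|))}`. -/
def V2 (L : ℕ) (Sstar S : Finset ℕ) : ℝ :=
  Real.exp ((1 / 2 ^ L) * (((S \ Sstar).card : ℝ) +
    min (((Sstar \ S).card : ℝ)) 1 * ((2 ^ L : ℝ) - ((S ∪ Sstar).card : ℝ))))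

/-- Drift ratio `R(𝒯, 𝒯̃) = V(𝒯̃)/V(𝒯) − 1`. -/
def driftR (V : Finset ℕ → ℝ) (S S' : Finset ℕ) : ℝ := V S' / V S - 1

/-- `(PV)(𝒯) = Σ_{𝒯̃ ∈ 𝕋_L} V(𝒯̃) P(𝒯, 𝒯̃)`. -/
def PV (L : ℕ) (P : Finset ℕ → Finset ℕ → ℝ) (V : Finset ℕ → ℝ) (S : Finset ℕ) : ℝ :=
  ∑ T ∈ trees L, V T * P S T

/-! ## Canonical paths -/

/-- The Bayesian CART canonical transition map `𝒢` toward `𝒯*`: if the tree has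
redundant internal nodes, remove the deepest rightmost one (maximal `j = 2^l + k`);
otherwise (when `𝒯 ⊂ 𝒯*`) add the deepest rightmost external node lying in `𝒯*_int`. -/
def gMap (Sstar S : Finset ℕ) : Finset ℕ :=
  if S = Sstar then S
  else
    match (S \ Sstar).max with
    | some j => S.erase j
    | none =>
      match ((extSet S) ∩ Sstar).max with
      | some j => insert j S
      | none => S

/-- The Twiggy canonical transition map toward `𝒯*`: if the tree has redundant
internal nodes, remove the shallowest leftmost one whose internal descendants form a
twig, together with its whole twig of descendants; otherwise grow the twig toward the
deepest rightmost node of `𝒯*_int` missing from `𝒯`. -/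
def gTwig (Sstar S : Finset ℕ) : Finset ℕ :=
  if S = Sstar then S
  else
    match ((S \ Sstar).filter fun j =>
        ∀ a ∈ descIn S j, ∀ b ∈ descIn S j, a = b ∨ isAnc a b ∨ isAnc b a).min with
    | some j => pruneTwig S j
    | none =>
      match (Sstar \ S).max with
      | some j => growTwig S j
      | none => S

/-- The set of states on the canonical path from `S` to `𝒯*` (iterating the
transition map `g`; `g` fixes `𝒯*`, and the fuel `2^(2L+2)` is ample). -/
def pathStates (L : ℕ) (g : Finset ℕ → Finset ℕ) (S : Finset ℕ) : Finset (Finset ℕ) :=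
  (Finset.range (2 ^ (2 * L + 2) + 1)).image fun t => g^[t] S

/-- The length `|T_{𝒯,𝒯'}|` of the collapsed canonical path between `𝒯` and `𝒯'`:
the number of states of either path to `𝒯*` that are not on the other path. -/
def pathLen (L : ℕ) (g : Finset ℕ → Finset ℕ) (S S' : Finset ℕ) : ℕ :=
  (pathStates L g S \ pathStates L g S').card + (pathStates L g S' \ pathStates L g S).card

/-- The directed edges traversed by the canonical path from `S` to `𝒯*`. -/
def pathEdges (L : ℕ) (g : Finset ℕ → Finset ℕ) (S : Finset ℕ) :
    Finset (Finset ℕ × Finset ℕ) :=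
  ((Finset.range (2 ^ (2 * L + 2))).image fun t => (g^[t] S, g^[t + 1] S)).filter
    fun e => e.1 ≠ e.2

/-- The edge `e` lies on the collapsed canonical path `T_{𝒯,𝒯'}` (in the forward
direction along `T_{𝒯,𝒯*}`, or backward along `T_{𝒯',𝒯*}`), the common portion of
the two paths being removed. -/
def onPath (L : ℕ) (g : Finset ℕ → Finset ℕ) (e : Finset ℕ × Finset ℕ)
    (S S' : Finset ℕ) : Prop :=
  (e ∈ pathEdges L g S ∧ e ∉ pathEdges L g S') ∨
    (e.swap ∈ pathEdges L g S' ∧ e.swap ∉ pathEdges L g S)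

instance (L : ℕ) (g : Finset ℕ → Finset ℕ) (e : Finset ℕ × Finset ℕ) (S S' : Finset ℕ) :
    Decidable (onPath L g e S S') := by unfold onPath; infer_instance

end BayesCART

namespace BayesCART

lemma gMap_self (Sstar : Finset ℕ) : gMap Sstar Sstar = Sstar := by
  simp [gMap]

lemma iterate_gMap_self (Sstar : Finset ℕ) (t : ℕ) : (gMap Sstar)^[t] Sstar = Sstar :=
  Function.iterate_fixed (gMap_self Sstar) t

/-- A root-containing proper subset of an ancestor-closed set has an external node in that set. -/
lemma extSet_inter_nonempty {Sstar S : Finset ℕ}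
    (hanc : ∀ j ∈ Sstar, 1 ≤ j → j / 2 ∈ Sstar) (h0 : 0 ∈ S) (hne : (Sstar \ S).Nonempty) :
    (extSet S ∩ Sstar).Nonempty := by
  obtain ⟨j, hj, hmin⟩ := (Sstar \ S).exists_min_image id hne
  rw [Finset.mem_sdiff] at hj
  have hpos : 1 ≤ j := Nat.one_le_iff_ne_zero.mpr fun h => hj.2 (h ▸ h0)
  have hhalf : j / 2 ∈ S := by
    by_contra hnot
    have hle := hmin (j / 2) (Finset.mem_sdiff.mpr ⟨hanc j hj.1 hpos, hnot⟩)
    simp only [id] at hle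
    omega
  refine ⟨j, Finset.mem_inter.mpr ⟨Finset.mem_filter.mpr ⟨?_, hj.2⟩, hj.1⟩⟩
  simp only [Finset.mem_union, Finset.mem_image]
  rcases Nat.mod_two_eq_zero_or_one j with h | h
  · exact Or.inl ⟨j / 2, hhalf, by omega⟩
  · exact Or.inr ⟨j / 2, hhalf, by omega⟩

/-- Away from the target, `gMap` either removes a redundant node or adds a missing one. -/
lemma gMap_eq_erase_or_insert {Sstar S : Finset ℕ}
    (hanc : ∀ j ∈ Sstar, 1 ≤ j → j / 2 ∈ Sstar) (h0 : 0 ∈ S) (hne : S ≠ Sstar) :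
    (∃ j ∈ S \ Sstar, gMap Sstar S = S.erase j) ∨
      ∃ j ∈ Sstar \ S, gMap Sstar S = insert j S := by
  unfold gMap
  rw [if_neg hne]
  split
  · next j hj => exact Or.inl ⟨j, Finset.mem_of_max hj, rfl⟩
  · next hmax =>
    have hsub : S ⊆ Sstar := Finset.sdiff_eq_empty_iff_subset.mp (Finset.max_eq_bot.mp hmax)
    have hdiff : (Sstar \ S).Nonempty :=
      Finset.sdiff_nonempty.mpr fun h => hne (hsub.antisymm h)
    split
    · next j hj =>
      have hmem := Finset.mem_inter.mp (Finset.mem_of_max hj)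
      exact Or.inr ⟨j, Finset.mem_sdiff.mpr ⟨hmem.2, (Finset.mem_filter.mp hmem.1).2⟩, rfl⟩
    · next hmax' =>
      exact absurd (Finset.max_eq_bot.mp hmax') (extSet_inter_nonempty hanc h0 hdiff).ne_empty

lemma zero_mem_gMap {Sstar S : Finset ℕ} (hstar0 : 0 ∈ Sstar)
    (hanc : ∀ j ∈ Sstar, 1 ≤ j → j / 2 ∈ Sstar) (h0 : 0 ∈ S) (hne : S ≠ Sstar) :
    0 ∈ gMap Sstar S := by
  rcases gMap_eq_erase_or_insert hanc h0 hne with ⟨j, hj, h⟩ | ⟨j, -, h⟩ <;> rw [h]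
  · exact Finset.mem_erase.mpr ⟨fun h' => (Finset.mem_sdiff.mp hj).2 (h' ▸ hstar0), h0⟩
  · exact Finset.mem_insert_of_mem h0

/-- Each application of `gMap` away from the target strictly reduces the distance to it. -/
lemma card_symmDiff_gMap_lt {Sstar S : Finset ℕ}
    (hanc : ∀ j ∈ Sstar, 1 ≤ j → j / 2 ∈ Sstar) (h0 : 0 ∈ S) (hne : S ≠ Sstar) :
    (symmDiff (gMap Sstar S) Sstar).card < (symmDiff S Sstar).card := by
  apply Finset.card_lt_card
  rw [Finset.ssubset_iff_of_subset]
  all_goals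
    rcases gMap_eq_erase_or_insert hanc h0 hne with ⟨j, hj, h⟩ | ⟨j, hj, h⟩ <;> rw [h]
  · exact ⟨j, by simp_all [Finset.mem_symmDiff], by simp_all [Finset.mem_symmDiff]⟩
  · exact ⟨j, by simp_all [Finset.mem_symmDiff], by simp_all [Finset.mem_symmDiff]⟩
  all_goals
    intro x
    simp only [Finset.mem_symmDiff, Finset.mem_sdiff, Finset.mem_erase, Finset.mem_insert] at hj ⊢
    grind

lemma iterate_gMap_eq_target {Sstar : Finset ℕ} (hstar0 : 0 ∈ Sstar)
    (hanc : ∀ j ∈ Sstar, 1 ≤ j → j / 2 ∈ Sstar) (t : ℕ) {S : Finset ℕ} (h0 : 0 ∈ S)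
    (hcard : (symmDiff S Sstar).card ≤ t) : (gMap Sstar)^[t] S = Sstar := by
  induction t generalizing S with
  | zero => exact symmDiff_eq_bot.mp (Finset.card_eq_zero.mp (Nat.le_zero.mp hcard))
  | succ t ih =>
    by_cases hne : S = Sstar
    · rw [hne, iterate_gMap_self]
    · rw [Function.iterate_succ_apply]
      have hlt := card_symmDiff_gMap_lt hanc h0 hne
      exact ih (zero_mem_gMap hstar0 hanc h0 hne) (by omega)

lemma iterate_gMap_two_pow {L : ℕ} {Sstar S : Finset ℕ} (hstar : Sstar ∈ trees L)
    (hS : S ∈ trees L) : (gMap Sstar)^[2 ^ L] S = Sstar := by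
  simp only [trees, Finset.mem_filter, Finset.mem_powerset] at hstar hS
  refine iterate_gMap_eq_target hstar.2.1 hstar.2.2.1 _ hS.2.1 ?_
  calc (symmDiff S Sstar).card ≤ (Finset.range (2 ^ L)).card :=
        Finset.card_le_card (symmDiff_le_sup.trans (Finset.union_subset hS.1 hstar.1))
    _ = 2 ^ L := Finset.card_range _

lemma target_mem_pathStates {L : ℕ} {Sstar S : Finset ℕ} (hstar : Sstar ∈ trees L)
    (hS : S ∈ trees L) : Sstar ∈ pathStates L (gMap Sstar) S :=
  Finset.mem_image.mpr ⟨2 ^ L,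
    Finset.mem_range.mpr (Nat.lt_succ_of_le (Nat.pow_le_pow_right two_pos (by omega))),
    iterate_gMap_two_pow hstar hS⟩

lemma card_pathStates_sdiff_le {L : ℕ} {Sstar S S' : Finset ℕ} (hstar : Sstar ∈ trees L)
    (hS : S ∈ trees L) (hS' : S' ∈ trees L) :
    (pathStates L (gMap Sstar) S \ pathStates L (gMap Sstar) S').card ≤ 2 ^ L := by
  have hsub : pathStates L (gMap Sstar) S \ pathStates L (gMap Sstar) S' ⊆
      (Finset.range (2 ^ L)).image fun t => (gMap Sstar)^[t] S := by
    intro T hT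
    obtain ⟨hT, hT'⟩ := Finset.mem_sdiff.mp hT
    obtain ⟨t, -, rfl⟩ := Finset.mem_image.mp hT
    refine Finset.mem_image_of_mem _ (Finset.mem_range.mpr ?_)
    by_contra! hle
    obtain ⟨s, rfl⟩ := Nat.exists_eq_add_of_le' hle
    rw [Function.iterate_add_apply, iterate_gMap_two_pow hstar hS, iterate_gMap_self] at hT'
    exact hT' (target_mem_pathStates hstar hS')
  exact (Finset.card_le_card hsub).trans (Finset.card_image_le.trans (Finset.card_range _).le)

/-- **Lemma (Canonical path length for Bayesian CART).**
Let `𝓔` be the canonical path ensemble for Bayesian CART built from the transition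
map `𝒢` toward a target tree `𝒯* ∈ 𝕋_L`.  Then the length of the canonical path
between any two trees `𝒯, 𝒯' ∈ 𝕋_L` is at most `2^{L+1}`; in particular
`ℓ(𝓔) = max_{𝒯,𝒯'∈𝕋_L} |T_{𝒯,𝒯'}| ≤ 2^{L+1}`. -/
theorem bcart_canonical_path_length
    (L : ℕ) (Sstar : Finset ℕ) (hstar : Sstar ∈ trees L)
    (S S' : Finset ℕ) (hS : S ∈ trees L) (hS' : S' ∈ trees L) :
    pathLen L (gMap Sstar) S S' ≤ 2 ^ (L + 1) := by
  have h := card_pathStates_sdiff_le hstar hS hS'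
  have h' := card_pathStates_sdiff_le hstar hS' hS
  rw [pow_succ, pathLen]
  omega

end BayesCART
end
end

section
/- Congestion bound for the Bayesian CART canonical path ensemble: Assume the model and Bayesian CART prior with p_{lk} = n^{-c}, c > 5/2, and Assumption 1(a). Then for every δ > 0 there exists N such that for all n ≥ N, with probability at least 1 − 4/n over ε ~ N(0, I_n), the congestion parameter of the Bayesian CART canonical path ensemble satisfies ρ(𝓔) ≤ 2^{L+1}(1 + δ). -/
open Finset MeasureTheory Real
open scoped BigOperators NNReal ENNReal

noncomputable section

namespace BayesCART

/-! ## Combinatorics of trees -/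

theorem mem_trees {L : ℕ} {S : Finset ℕ} : S ∈ trees L ↔ IsTree L S := by
  simp only [trees, mem_filter, mem_powerset, and_iff_right_iff_imp]
  exact fun h j hj => mem_range.2 (h.2.2 j hj)

/-- A tree has as many external nodes as internal nodes. -/
theorem card_extSet {L : ℕ} {S : Finset ℕ} (h : IsTree L S) : (extSet S).card = S.card := by
  set Ch := (S.image fun j => 2 * j) ∪ S.image fun j => 2 * j + 1 with hCh
  have hsub : S ⊆ Ch := by
    intro j hj
    rw [hCh, mem_union, mem_image, mem_image]
    rcases Nat.eq_zero_or_pos j with rfl | hpos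
    · exact Or.inl ⟨0, hj, rfl⟩
    · have := h.2.1 j hj hpos
      rcases Nat.even_or_odd' j with ⟨k, hk | hk⟩
      · exact Or.inl ⟨j / 2, this, by omega⟩
      · exact Or.inr ⟨j / 2, this, by omega⟩
  have hext : extSet S = Ch \ S := by
    ext j; simp only [extSet, mem_filter, mem_sdiff, hCh]
  have hcard : Ch.card = 2 * S.card := by
    rw [hCh, card_union_of_disjoint, card_image_of_injective, card_image_of_injective]
    · ring
    · intro a b hab; simp only at hab; omega
    · intro a b hab; simp only at hab; omega
    · rw [disjoint_left]
      intro a ha hb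
      obtain ⟨x, -, rfl⟩ := mem_image.1 ha
      obtain ⟨y, -, hy⟩ := mem_image.1 hb
      omega
  rw [hext, card_sdiff_of_subset hsub, hcard]
  omega

/-- A family of nodes of depth `< L`, none a proper leftmost descendant of another, has at most
`2 ^ (L - 1)` elements. -/
theorem card_le_of_not_leftmost {L : ℕ} {Q : Finset ℕ} (hQ : ∀ j ∈ Q, 1 ≤ j ∧ j < 2 ^ L)
    (hanti : ∀ j ∈ Q, ∀ t, j * 2 ^ (t + 1) ∉ Q) : Q.card ≤ 2 ^ (L - 1) := by
  rcases Nat.eq_zero_or_pos L with rfl | hL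
  · have : Q = ∅ := by
      refine eq_empty_of_forall_notMem fun j hj => ?_
      have := hQ j hj
      simp only [pow_zero] at this
      omega
    simp [this]
  have hlog : ∀ j ∈ Q, Nat.log 2 j + (L - 1 - Nat.log 2 j) = L - 1 := by
    intro j hj
    have : Nat.log 2 j < L := Nat.log_lt_of_lt_pow (by have := hQ j hj; omega) (hQ j hj).2
    omega
  have key : Q.card ≤ (Finset.Ico (2 ^ (L - 1)) (2 ^ L)).card := by
    refine card_le_card_of_injOn (fun j => j * 2 ^ (L - 1 - Nat.log 2 j)) ?_ ?_
    · intro j hj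
      have hj : j ∈ Q := hj
      have h1 := Nat.pow_log_le_self 2 (x := j) (by have := hQ j hj; omega)
      have h2 := Nat.lt_pow_succ_log_self (b := 2) (by norm_num) j
      have h3 := hlog j hj
      have e1 : 2 ^ (L - 1) = 2 ^ Nat.log 2 j * 2 ^ (L - 1 - Nat.log 2 j) := by
        rw [← pow_add, h3]
      have e2 : 2 ^ L = 2 ^ (Nat.log 2 j + 1) * 2 ^ (L - 1 - Nat.log 2 j) := by
        rw [← pow_add]; congr 1; omega
      simp only [coe_Ico, Set.mem_Ico]
      rw [e1, e2]
      exact ⟨Nat.mul_le_mul_right _ h1, Nat.mul_lt_mul_of_pos_right h2 (by positivity)⟩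
    · have aux : ∀ i ∈ Q, ∀ j ∈ Q, Nat.log 2 i ≤ Nat.log 2 j →
          i * 2 ^ (L - 1 - Nat.log 2 i) = j * 2 ^ (L - 1 - Nat.log 2 j) → i = j := by
        intro i hi j hj hle hij
        have h1 := hlog i hi
        have h2 := hlog j hj
        have e : L - 1 - Nat.log 2 i = (Nat.log 2 j - Nat.log 2 i) + (L - 1 - Nat.log 2 j) := by
          omega
        rw [e, pow_add, ← mul_assoc] at hij
        have hij := Nat.eq_of_mul_eq_mul_right (by positivity) hij
        rcases h : Nat.log 2 j - Nat.log 2 i with _ | t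
        · rw [h] at hij; simpa using hij
        · rw [h] at hij
          exact absurd (hij ▸ hj) (hanti i hi t)
      intro i hi j hj hij
      rcases le_total (Nat.log 2 i) (Nat.log 2 j) with h | h
      · exact aux i hi j hj h hij
      · exact (aux j hj i hi h hij.symm).symm
  refine key.trans_eq ?_
  rw [Nat.card_Ico]
  obtain ⟨m, rfl⟩ : ∃ m, L = m + 1 := ⟨L - 1, by omega⟩
  simp only [Nat.add_sub_cancel, pow_succ]
  omega

/-- Every left ancestor of an internal node is internal. -/
theorem IsTree.mem_of_mul_pow_mem {L : ℕ} {S : Finset ℕ} (h : IsTree L S) {j : ℕ} (t : ℕ)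
    (hj : j * 2 ^ t ∈ S) : j ∈ S := by
  induction t with
  | zero => simpa using hj
  | succ t ih =>
    rcases Nat.eq_zero_or_pos j with rfl | hpos
    · exact h.1
    · refine ih ?_
      have := h.2.1 _ hj (Nat.mul_pos hpos (by positivity))
      rwa [pow_succ, ← mul_assoc, Nat.mul_div_cancel _ (by norm_num)] at this

theorem card_pruneCands_le {L : ℕ} {S : Finset ℕ} (h : IsTree L S) :
    (pruneCands S).card ≤ 2 ^ (L - 1) := by
  refine card_le_of_not_leftmost ?_ ?_
  · intro j hj
    simp only [pruneCands, mem_filter] at hj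
    exact ⟨Nat.one_le_iff_ne_zero.2 hj.2.1, h.2.2 j hj.1⟩
  · intro j hj t ht
    simp only [pruneCands, mem_filter] at hj ht
    refine hj.2.2.1 (h.mem_of_mul_pow_mem t ?_)
    convert ht.1 using 1
    ring

theorem mem_growCands {L : ℕ} {S : Finset ℕ} {j : ℕ} :
    j ∈ growCands L S ↔ j / 2 ∈ S ∧ j ∉ S ∧ j < 2 ^ L := by
  simp only [growCands, extSet, mem_filter, mem_union, mem_image]
  constructor
  · rintro ⟨⟨⟨a, ha, rfl⟩ | ⟨a, ha, rfl⟩, h1⟩, h2⟩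
    · exact ⟨by rwa [Nat.mul_div_cancel_left _ (by norm_num)], h1, h2⟩
    · exact ⟨by rwa [show (2 * a + 1) / 2 = a by omega], h1, h2⟩
  · rintro ⟨h0, h1, h2⟩
    refine ⟨⟨?_, h1⟩, h2⟩
    rcases Nat.even_or_odd' j with ⟨k, hk | hk⟩
    · exact Or.inl ⟨j / 2, h0, by omega⟩
    · exact Or.inr ⟨j / 2, h0, by omega⟩

theorem card_growCands_le {L : ℕ} {S : Finset ℕ} (h : IsTree L S) :
    (growCands L S).card ≤ 2 ^ (L - 1) := by
  refine card_le_of_not_leftmost ?_ ?_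
  · intro j hj
    rw [mem_growCands] at hj
    refine ⟨Nat.one_le_iff_ne_zero.2 ?_, hj.2.2⟩
    rintro rfl
    exact hj.2.1 h.1
  · intro j hj t ht
    rw [mem_growCands] at hj ht
    refine hj.2.1 (h.mem_of_mul_pow_mem t ?_)
    convert ht.1 using 1
    rw [pow_succ, ← mul_assoc, Nat.mul_div_cancel _ (by norm_num)]

/-- If two trees differ by one node, that node may be grown from the small tree and pruned from
the large one. -/
theorem mem_cands_of_insert {L : ℕ} {S : Finset ℕ} {j : ℕ} (hS : IsTree L S)
    (hS' : IsTree L (insert j S)) (hj : j ∉ S) :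
    j ∈ growCands L S ∧ j ∈ pruneCands (insert j S) := by
  have hj0 : j ≠ 0 := by rintro rfl; exact hj hS.1
  constructor
  · rw [mem_growCands]
    refine ⟨?_, hj, hS'.2.2 j (mem_insert_self _ _)⟩
    have := hS'.2.1 j (mem_insert_self _ _) (by omega)
    rw [mem_insert] at this
    exact this.resolve_left (by omega)
  · simp only [pruneCands, mem_filter, mem_insert_self, true_and, mem_insert, not_or]
    refine ⟨hj0, ⟨by omega, fun h => hj ?_⟩, ⟨by omega, fun h => hj ?_⟩⟩
    · simpa using hS.2.1 _ h (by omega)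
    · have := hS.2.1 _ h (by omega)
      rwa [show (2 * j + 1) / 2 = j by omega] at this

theorem half_div_le {L m k : ℕ} (hL : 1 ≤ L) (hm : m ≤ 2 ^ (L - 1)) (hm0 : 1 ≤ m) (hk : 1 ≤ k)
    {f : ℝ} (hf : 1 / 2 ≤ f) : ((2 : ℝ) ^ L)⁻¹ ≤ f * (k / m) := by
  have e : ((2 : ℝ) ^ L)⁻¹ = 1 / 2 * (1 / 2 ^ (L - 1)) := by
    obtain ⟨l, rfl⟩ : ∃ l, L = l + 1 := ⟨L - 1, by omega⟩
    simp only [Nat.add_sub_cancel, pow_succ]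
    field_simp
  have hm' : (m : ℝ) ≤ 2 ^ (L - 1) := by exact_mod_cast hm
  have hm0' : (0 : ℝ) < m := by exact_mod_cast hm0
  have hk' : (1 : ℝ) ≤ k := by exact_mod_cast hk
  rw [e]
  gcongr

/-- The proposal moves between neighbouring trees with probability at least `2 ^ (-L)`. -/
theorem bcartProp_ge {L : ℕ} {S : Finset ℕ} {j : ℕ} (hS : IsTree L S)
    (hS' : IsTree L (insert j S)) (hj : j ∉ S) :
    ((2 : ℝ) ^ L)⁻¹ ≤ bcartProp L S (insert j S) ∧
      ((2 : ℝ) ^ L)⁻¹ ≤ bcartProp L (insert j S) S := by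
  obtain ⟨hg, hp⟩ := mem_cands_of_insert hS hS' hj
  have hL : 1 ≤ L := by
    by_contra h
    have h0 : L = 0 := by omega
    have := (mem_growCands.1 hg).2.2
    rw [h0, pow_zero] at this
    exact hj ((by omega : j = 0) ▸ hS.1)
  have hhalf : ∀ (P : Prop) [Decidable P], (1 : ℝ) / 2 ≤ if P then (1 : ℝ) / 2 else 1 := by
    intro P _
    split_ifs <;> norm_num
  have hg1 : 1 ≤ (growCands L S).card := one_le_card.2 ⟨j, hg⟩
  have hg2 : 1 ≤ ((growCands L S).filter fun i => insert i S = insert j S).card :=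
    one_le_card.2 ⟨j, mem_filter.2 ⟨hg, rfl⟩⟩
  have hp1 : 1 ≤ (pruneCands (insert j S)).card := one_le_card.2 ⟨j, hp⟩
  have hp2 : 1 ≤ ((pruneCands (insert j S)).filter fun i => (insert j S).erase i = S).card :=
    one_le_card.2 ⟨j, mem_filter.2 ⟨hp, erase_insert hj⟩⟩
  constructor
  · refine le_add_of_le_of_nonneg
      (half_div_le hL (card_growCands_le hS) hg1 hg2 (hhalf _)) ?_
    exact mul_nonneg (le_trans (by norm_num) (hhalf _)) (by positivity)
  · refine le_add_of_nonneg_of_le ?_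
      (half_div_le hL (card_pruneCands_le hS') hp1 hp2 (hhalf _))
    exact mul_nonneg (le_trans (by norm_num) (hhalf _)) (by positivity)

/-! ## Canonical paths -/

/-- One step of the transition map fixes the tree, removes a redundant node, or adds a missing
node of the target. -/
theorem gMap_cases (Sstar S : Finset ℕ) :
    gMap Sstar S = S ∨ (∃ j ∈ S \ Sstar, gMap Sstar S = S.erase j) ∨
      ∃ j ∈ Sstar \ S, gMap Sstar S = insert j S := by
  unfold gMap
  split_ifs with h
  · exact Or.inl rfl
  · split
    · rename_i j hj
      exact Or.inr (Or.inl ⟨j, mem_of_max hj, rfl⟩)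
    · split
      · rename_i j hj
        have := mem_of_max hj
        simp only [extSet, mem_inter, mem_filter] at this
        exact Or.inr (Or.inr ⟨j, mem_sdiff.2 ⟨this.2, this.1.2⟩, rfl⟩)
      · exact Or.inl rfl

theorem iterate_gMap_sdiff (Sstar S : Finset ℕ) (t : ℕ) :
    Disjoint (S \ (gMap Sstar)^[t] S) Sstar ∧ (gMap Sstar)^[t] S \ S ⊆ Sstar := by
  induction t with
  | zero => simp
  | succ t ih =>
    rw [Function.iterate_succ_apply']
    set V := (gMap Sstar)^[t] S
    obtain ⟨h1, h2⟩ := ih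
    rw [disjoint_left] at h1 ⊢
    simp only [mem_sdiff, and_imp, subset_iff] at h1 h2 ⊢
    rcases gMap_cases Sstar V with h | ⟨j, hj, h⟩ | ⟨j, hj, h⟩ <;> rw [h]
    · exact ⟨h1, h2⟩
    · simp only [mem_sdiff] at hj
      refine ⟨fun a ha hb => ?_, fun a ha => h2 (mem_of_mem_erase ha)⟩
      by_cases haj : a = j
      · rw [haj]; exact hj.2
      · exact h1 ha fun hV => hb (mem_erase.2 ⟨haj, hV⟩)
    · simp only [mem_sdiff] at hj
      refine ⟨fun a ha hb => h1 ha fun hV => hb (mem_insert_of_mem hV), fun a ha hb => ?_⟩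
      rcases mem_insert.1 ha with rfl | ha
      · exact hj.1
      · exact h2 ha hb

theorem of_mem_pathEdges {L : ℕ} {g : Finset ℕ → Finset ℕ} {S U U' : Finset ℕ}
    (h : (U, U') ∈ pathEdges L g S) : (∃ t, g^[t] S = U) ∧ U' = g U ∧ U ≠ U' := by
  simp only [pathEdges, mem_filter, mem_image, Prod.mk.injEq] at h
  obtain ⟨⟨t, -, h1, h2⟩, h3⟩ := h
  refine ⟨⟨t, h1⟩, ?_, h3⟩
  rw [← h2, ← h1, Function.iterate_succ_apply']

/-! ## Orthogonality of the Haar design -/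

/-- The Haar wavelet with shift `m` as a function of the index of a dyadic cell of half the
length of its support. -/
def haarStep (m q : ℕ) : ℝ := if q = 2 * m then 1 else if q = 2 * m + 1 then -1 else 0

theorem haarCol_eq_haarStep {M j : ℕ} (hj : j ≠ 0) (hjM : Nat.log 2 j < M) (i : ℕ) :
    haarCol (2 ^ M) j i = (2 : ℝ) ^ ((Nat.log 2 j : ℝ) / 2) *
      haarStep (j - 2 ^ Nat.log 2 j) (i / 2 ^ (M - 1 - Nat.log 2 j)) := by
  unfold haarCol
  rw [if_neg hj]
  congr 1
  set l := Nat.log 2 j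
  set m := j - 2 ^ l
  obtain ⟨h, rfl⟩ : ∃ h, M = l + (h + 1) := ⟨M - 1 - l, by omega⟩
  have e0 : l + (h + 1) - 1 - l = h := by omega
  rw [e0]
  have hp : (0 : ℝ) < 2 ^ h := by positivity
  have hpn : 0 < 2 ^ h := by positivity
  have e1 : (2 : ℝ) ^ l * (((i : ℝ) + 1) / ((2 ^ (l + (h + 1)) : ℕ) : ℝ)) - (m : ℝ)
      = ((i : ℝ) + 1 - 2 * m * 2 ^ h) / (2 * 2 ^ h) := by
    push_cast
    rw [pow_add, pow_succ]
    field_simp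
  rw [e1]
  have c1 : 0 < ((i : ℝ) + 1 - 2 * m * 2 ^ h) / (2 * 2 ^ h) ↔ 2 * m * 2 ^ h < i + 1 := by
    rw [lt_div_iff₀ (by positivity), zero_mul, sub_pos]
    norm_cast
  have c2 : ((i : ℝ) + 1 - 2 * m * 2 ^ h) / (2 * 2 ^ h) ≤ 1 / 2 ↔
      i + 1 ≤ 2 * m * 2 ^ h + 2 ^ h := by
    rw [div_le_iff₀ (by positivity), show (1 : ℝ) / 2 * (2 * 2 ^ h) = 2 ^ h by ring,
      sub_le_iff_le_add']
    norm_cast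
  have c3 : 1 / 2 < ((i : ℝ) + 1 - 2 * m * 2 ^ h) / (2 * 2 ^ h) ↔
      2 * m * 2 ^ h + 2 ^ h < i + 1 := by
    rw [← not_le, c2, not_le]
  have c4 : ((i : ℝ) + 1 - 2 * m * 2 ^ h) / (2 * 2 ^ h) ≤ 1 ↔
      i + 1 ≤ 2 * m * 2 ^ h + 2 * 2 ^ h := by
    rw [div_le_iff₀ (by positivity), one_mul, sub_le_iff_le_add']
    norm_cast
  have d1 : i / 2 ^ h = 2 * m ↔ 2 * m * 2 ^ h ≤ i ∧ i < 2 * m * 2 ^ h + 2 ^ h := by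
    rw [Nat.div_eq_iff hpn]
    constructor <;> intro hh <;> constructor <;> omega
  have d2 : i / 2 ^ h = 2 * m + 1 ↔
      2 * m * 2 ^ h + 2 ^ h ≤ i ∧ i < 2 * m * 2 ^ h + 2 * 2 ^ h := by
    rw [Nat.div_eq_iff hpn, add_mul]
    constructor <;> intro hh <;> constructor <;> omega
  unfold haarMother haarStep
  simp only [c1, c2, c3, c4, d1, d2]
  congr 1
  · rw [Nat.lt_succ_iff, Nat.succ_le_iff]
  · congr 1
    rw [Nat.lt_succ_iff, Nat.succ_le_iff]

theorem sum_range_mul_div (a b : ℕ) (hb : 0 < b) (F : ℕ → ℝ) :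
    ∑ i ∈ range (a * b), F (i / b) = b * ∑ q ∈ range a, F q := by
  induction a with
  | zero => simp
  | succ a ih =>
    rw [add_mul, one_mul, sum_range_add, ih, sum_range_succ, mul_add]
    congr 1
    rw [sum_congr rfl (g := fun _ => F a), sum_const, card_range, nsmul_eq_mul]
    intro x hx
    rw [mul_comm, Nat.mul_add_div hb, Nat.div_eq_of_lt (mem_range.1 hx), add_zero]

theorem sum_mul_haarStep {m a : ℕ} (h : 2 * m + 1 < a) (F : ℕ → ℝ) :
    ∑ q ∈ range a, F q * haarStep m q = F (2 * m) - F (2 * m + 1) := by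
  have : ∀ q ∈ range a, F q * haarStep m q =
      (if q = 2 * m then F q else 0) - if q = 2 * m + 1 then F q else 0 := by
    intro q _
    unfold haarStep
    split_ifs with h1 h2 h2
    · omega
    · ring
    · ring
    · ring
  rw [sum_congr rfl this, sum_sub_distrib, sum_ite_eq', sum_ite_eq',
    if_pos (mem_range.2 (by omega)), if_pos (mem_range.2 h)]

theorem haarCol_inner_of_log_le {M j k : ℕ} (hk : k ≠ 0) (hkM : Nat.log 2 k < M)
    (hjk : Nat.log 2 j ≤ Nat.log 2 k) :
    ∑ i ∈ range (2 ^ M), haarCol (2 ^ M) j i * haarCol (2 ^ M) k i =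
      if j = k then (2 : ℝ) ^ M else 0 := by
  set l := Nat.log 2 k with hl
  have hk1 : 2 ^ l ≤ k := Nat.pow_log_le_self 2 hk
  have hk2 : k < 2 ^ (l + 1) := Nat.lt_pow_succ_log_self (by norm_num) k
  set m := k - 2 ^ l with hm
  set h := M - 1 - l with hh
  have hm' : 2 * m + 1 < 2 ^ (l + 1) := by rw [pow_succ] at hk2 ⊢; omega
  have hM : (2 : ℕ) ^ M = 2 ^ (l + 1) * 2 ^ h := by rw [← pow_add]; congr 1; omega
  have reduce : ∀ F : ℕ → ℝ, (∀ i, haarCol (2 ^ M) j i = F (i / 2 ^ h)) →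
      ∑ i ∈ range (2 ^ M), haarCol (2 ^ M) j i * haarCol (2 ^ M) k i =
        2 ^ h * ((2 : ℝ) ^ ((l : ℝ) / 2) * (F (2 * m) - F (2 * m + 1))) := by
    intro F hF
    have : ∀ i ∈ range (2 ^ M), haarCol (2 ^ M) j i * haarCol (2 ^ M) k i =
        (fun q => (2 : ℝ) ^ ((l : ℝ) / 2) * (F q * haarStep m q)) (i / 2 ^ h) := by
      intro i _
      rw [hF, haarCol_eq_haarStep hk hkM]
      ring
    rw [sum_congr rfl this, hM, sum_range_mul_div _ _ (by positivity) (fun q => _ * (F q * haarStep m q)),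
      ← mul_sum,
      sum_mul_haarStep hm']
    push_cast
    ring
  rcases eq_or_ne j 0 with rfl | hj
  · rw [reduce (fun _ => 1) (fun i => by simp [haarCol]), if_neg (Ne.symm hk)]
    simp
  · have hj1 := Nat.pow_log_le_self 2 hj
    rw [reduce (fun q => (2 : ℝ) ^ ((Nat.log 2 j : ℝ) / 2) *
      haarStep (j - 2 ^ Nat.log 2 j) (q / 2 ^ (l - Nat.log 2 j))) ?_]
    · rcases hjk.lt_or_eq with hlt | heq
      · obtain ⟨d, hd⟩ : ∃ d, l - Nat.log 2 j = d + 1 := ⟨l - Nat.log 2 j - 1, by omega⟩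
        have e : (2 * m + 1) / 2 ^ (d + 1) = 2 * m / 2 ^ (d + 1) := by
          rw [pow_succ', ← Nat.div_div_eq_div_mul, ← Nat.div_div_eq_div_mul]
          congr 1
          omega
        have hne : j ≠ k := by rintro rfl; exact absurd hlt (lt_irrefl _)
        simp only [hd, e, sub_self, mul_zero, if_neg hne]
      · have e : (2 : ℝ) ^ ((l : ℝ) / 2) * (2 : ℝ) ^ ((l : ℝ) / 2) = 2 ^ l := by
          rw [← Real.rpow_add (by norm_num), ← Real.rpow_natCast]
          congr 1
          ring
        rw [heq] at hj1
        simp only [heq, Nat.sub_self, pow_zero, Nat.div_one]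
        by_cases hne : j = k
        · rw [if_pos hne, hne, ← hm]
          simp only [haarStep, if_true, Nat.succ_ne_self, if_false]
          rw [show M = l + (h + 1) by omega, pow_add, pow_succ, ← e]
          ring
        · rw [if_neg hne]
          have n1 : 2 * m ≠ 2 * (j - 2 ^ l) := by omega
          have n2 : 2 * m ≠ 2 * (j - 2 ^ l) + 1 := by omega
          have n3 : 2 * m + 1 ≠ 2 * (j - 2 ^ l) := by omega
          have n4 : 2 * m + 1 ≠ 2 * (j - 2 ^ l) + 1 := by omega
          simp only [haarStep, if_neg n1, if_neg n2, if_neg n3, if_neg n4, sub_self, mul_zero]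
    · intro i
      rw [haarCol_eq_haarStep hj (by omega), Nat.div_div_eq_div_mul, ← pow_add]
      congr 4
      omega

/-- The Haar design is orthogonal: `X'X = nI`. -/
theorem haarCol_inner {M j k : ℕ} (hj : j < 2 ^ M) (hk : k < 2 ^ M) :
    ∑ i : Fin (2 ^ M), haarCol (2 ^ M) j i * haarCol (2 ^ M) k i =
      if j = k then (2 : ℝ) ^ M else 0 := by
  rw [Fin.sum_univ_eq_sum_range (fun i => haarCol (2 ^ M) j i * haarCol (2 ^ M) k i)]
  rcases eq_or_ne k 0 with rfl | hk0
  · rcases eq_or_ne j 0 with rfl | hj0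
    · simp [haarCol]
    · rw [sum_congr rfl fun i _ => mul_comm _ _,
        haarCol_inner_of_log_le hj0 (Nat.log_lt_of_lt_pow hj0 hj) (by simp)]
      simp only [eq_comm]
  · rcases le_total (Nat.log 2 j) (Nat.log 2 k) with h | h
    · exact haarCol_inner_of_log_le hk0 (Nat.log_lt_of_lt_pow hk0 hk) h
    · rcases eq_or_ne j 0 with rfl | hj0
      · exact haarCol_inner_of_log_le hk0 (Nat.log_lt_of_lt_pow hk0 hk) (by simp)
      · rw [sum_congr rfl fun i _ => mul_comm _ _,
          haarCol_inner_of_log_le hj0 (Nat.log_lt_of_lt_pow hj0 hj) h]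
        simp only [eq_comm]

theorem colDot_Yvec {M j : ℕ} (hj : j < 2 ^ M) {β : ℕ → ℝ} {B : Finset ℕ}
    (hB : ∀ k ∈ B, k < 2 ^ M) (ε : Fin (2 ^ M) → ℝ) :
    colDot (2 ^ M) (Yvec (2 ^ M) β B ε) j =
      (if j ∈ B then 2 ^ M * β j else 0) + colDot (2 ^ M) ε j := by
  simp only [colDot, Yvec, mul_add, sum_add_distrib]
  congr 1
  simp only [signalVec, mul_sum]
  rw [sum_comm, ← sum_ite_eq B j (fun k => (2 : ℝ) ^ M * β k)]
  refine sum_congr rfl fun k hk => ?_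
  have : ∀ i : Fin (2 ^ M), haarCol (2 ^ M) j i * (β k * haarCol (2 ^ M) k i) =
      β k * (haarCol (2 ^ M) j i * haarCol (2 ^ M) k i) := fun i => by ring
  simp only [this]
  rw [← mul_sum, haarCol_inner hj (hB k hk)]
  split_ifs <;> ring

/-! ## The noise -/

theorem gauss_sum_ge_le {n : ℕ} (a : Fin n → ℝ) {v t : ℝ} (hv : ∑ i, a i ^ 2 = v)
    (ht : 0 ≤ t) :
    (gauss n).real {ε | t ≤ ∑ i, a i * ε i} ≤ Real.exp (-t ^ 2 / (2 * v)) := by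
  have hg : ProbabilityTheory.HasSubgaussianMGF id 1 (ProbabilityTheory.gaussianReal 0 1) := by
    refine ⟨fun t => ProbabilityTheory.integrable_exp_mul_gaussianReal t, fun t => ?_⟩
    rw [ProbabilityTheory.mgf_id_gaussianReal]
    simp
  have hind : ProbabilityTheory.iIndepFun (fun (i : Fin n) (ε : Fin n → ℝ) => a i * ε i)
      (gauss n) :=
    ProbabilityTheory.iIndepFun_pi (X := fun i x => a i * x)
      (fun i => (measurable_const_mul (a i)).aemeasurable)
  have hsub : ∀ i ∈ (univ : Finset (Fin n)), ProbabilityTheory.HasSubgaussianMGF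
      (fun ε : Fin n → ℝ => a i * ε i) (.mk (a i ^ 2) (sq_nonneg _) * 1) (gauss n) := by
    intro i _
    refine ProbabilityTheory.HasSubgaussianMGF.const_mul ?_ (a i)
    have hev := measurePreserving_eval
      (fun _ : Fin n => ProbabilityTheory.gaussianReal 0 1) i
    refine ProbabilityTheory.HasSubgaussianMGF.of_map (Y := Function.eval i) (X := id)
      hev.measurable.aemeasurable ?_
    have e : (gauss n).map (Function.eval i) = ProbabilityTheory.gaussianReal 0 1 := hev.map_eq
    rw [e]
    exact hg
  have := ProbabilityTheory.HasSubgaussianMGF.measure_sum_ge_le_of_iIndepFun hind hsub ht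
  refine this.trans_eq ?_
  rw [← hv, NNReal.coe_sum]
  simp only [mul_one, NNReal.coe_mk]

theorem gauss_abs_colDot_bound {M L : ℕ} (hL : L < M) :
    ENNReal.ofReal (1 - 4 / (2 ^ M : ℕ)) ≤ gauss (2 ^ M) {ε | ∀ j < 2 ^ L,
      |colDot (2 ^ M) ε j| < 2 * √((2 ^ M : ℕ) * Real.log (2 ^ M : ℕ))} := by
  set n := 2 ^ M with hn
  have hn1 : (1 : ℝ) ≤ n := by rw [hn]; exact_mod_cast Nat.one_le_two_pow
  have hn0 : (0 : ℝ) < n := by linarith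
  have hlog : 0 ≤ Real.log n := Real.log_nonneg hn1
  set t := 2 * √(n * Real.log n) with ht
  have htn : 0 ≤ t := by positivity
  have htsq : -t ^ 2 / (2 * n) = -(2 * Real.log n) := by
    rw [ht, mul_pow, Real.sq_sqrt (by positivity)]
    field_simp
  have hexp : Real.exp (-t ^ 2 / (2 * n)) = 1 / n ^ 2 := by
    rw [htsq, Real.exp_neg, two_mul, Real.exp_add, Real.exp_log hn0]
    field_simp
  have : IsProbabilityMeasure (gauss n) := by unfold gauss; infer_instance
  set E := {ε : Fin n → ℝ | ∀ j < 2 ^ L, |colDot n ε j| < t} with hE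
  have hsq : ∀ j < 2 ^ L, ∑ i : Fin n, haarCol n j i ^ 2 = n := by
    intro j hj
    have hj' : j < 2 ^ M := hj.trans (Nat.pow_lt_pow_right (by norm_num) hL)
    have := haarCol_inner hj' hj'
    rw [if_pos rfl] at this
    simp only [pow_two]
    rw [hn]
    exact_mod_cast this
  have hcompl : (gauss n).real Eᶜ ≤ 4 / n := by
    have hsub : Eᶜ ⊆ ⋃ j ∈ range (2 ^ L), ({ε : Fin n → ℝ | t ≤ ∑ i : Fin n, haarCol n j i * ε i} ∪
        {ε : Fin n → ℝ | t ≤ ∑ i : Fin n, -haarCol n j i * ε i}) := by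
      intro ε hε
      simp only [hE, Set.mem_compl_iff, Set.mem_ofPred_eq, not_forall, not_lt] at hε
      obtain ⟨j, hj, hjt⟩ := hε
      simp only [Set.mem_iUnion]
      refine ⟨j, mem_range.2 hj, ?_⟩
      rcases le_abs.1 hjt with h | h
      · exact Or.inl h
      · right
        simp only [Set.mem_ofPred_eq, neg_mul, sum_neg_distrib]
        exact h
    calc (gauss n).real Eᶜ ≤ _ := measureReal_mono hsub (measure_ne_top _ _)
      _ ≤ ∑ j ∈ range (2 ^ L), (gauss n).real _ := measureReal_biUnion_finset_le _ _
      _ ≤ ∑ j ∈ range (2 ^ L), 2 * (1 / (n : ℝ) ^ 2) := by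
        refine sum_le_sum fun j hj => (measureReal_union_le _ _).trans ?_
        have hj := hsq j (mem_range.1 hj)
        rw [two_mul, ← hexp]
        refine add_le_add (gauss_sum_ge_le _ hj htn) (gauss_sum_ge_le _ ?_ htn)
        simpa using hj
      _ = 2 ^ L * (2 * (1 / (n : ℝ) ^ 2)) := by simp
      _ ≤ n * (2 * (1 / (n : ℝ) ^ 2)) := by
        gcongr
        rw [hn]
        push_cast
        exact pow_le_pow_right₀ (by norm_num) hL.le
      _ = 2 / n := by field_simp
      _ ≤ 4 / n := by gcongr; norm_num
  have hone : 1 ≤ (gauss n).real E + (gauss n).real Eᶜ := by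
    rw [← probReal_univ (μ := gauss n), ← Set.union_compl_self E]
    exact measureReal_union_le _ _
  rw [← ofReal_measureReal (measure_ne_top _ _)]
  exact ENNReal.ofReal_le_ofReal (by linarith)

/-! ## The posterior as a product over nodes -/

/-- The factor contributed by the internal node `j` to the unnormalized posterior. -/
def nodeWt (n : ℕ) (p : ℝ) (Y : Fin n → ℝ) (j : ℕ) : ℝ :=
  p * (1 - p) * (1 + n : ℝ) ^ (-(1 : ℝ) / 2) *
    Real.exp (colDot n Y j ^ 2 / (2 * ((n : ℝ) + 1)))

theorem nodeWt_pos {n : ℕ} {p : ℝ} (hp : 0 < p) (hp1 : p < 1) (Y : Fin n → ℝ) (j : ℕ) :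
    0 < nodeWt n p Y j := by
  have : 0 < 1 - p := by linarith
  unfold nodeWt
  positivity

theorem postWt_eq {L n : ℕ} (p : ℝ) (Y : Fin n → ℝ) {S : Finset ℕ} (hS : IsTree L S) :
    postWt n p Y S = (2 * π) ^ (-(n : ℝ) / 2) * Real.exp (-(1 / 2) * ∑ i, Y i ^ 2) *
      ∏ j ∈ S, nodeWt n p Y j := by
  have hpow : (1 + n : ℝ) ^ (-((extSet S).card : ℝ) / 2) =
      ((1 + n : ℝ) ^ (-(1 : ℝ) / 2)) ^ S.card := by
    rw [← Real.rpow_natCast, ← Real.rpow_mul (by positivity), card_extSet hS]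
    congr 1
    ring
  have hexp : Real.exp (-(1 / 2) * ((∑ i, Y i ^ 2) - (1 / ((n : ℝ) + 1)) *
      ∑ j ∈ S, colDot n Y j ^ 2)) = Real.exp (-(1 / 2) * ∑ i, Y i ^ 2) *
      ∏ j ∈ S, Real.exp (colDot n Y j ^ 2 / (2 * ((n : ℝ) + 1))) := by
    rw [← Real.exp_sum, ← Real.exp_add, ← sum_div]
    congr 1
    field_simp
    ring
  simp only [postWt, priorWt, margLik, nodeWt]
  rw [hpow, hexp, card_extSet hS, prod_mul_distrib, prod_const, mul_pow, mul_pow]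
  ring

theorem postWt_pos {L n : ℕ} {p : ℝ} (hp : 0 < p) (hp1 : p < 1) (Y : Fin n → ℝ)
    {S : Finset ℕ} (hS : IsTree L S) : 0 < postWt n p Y S := by
  rw [postWt_eq p Y hS]
  have := prod_pos fun j (_ : j ∈ S) => nodeWt_pos hp hp1 Y j
  positivity

theorem sum_postWt_pos {L n : ℕ} {p : ℝ} (hp : 0 < p) (hp1 : p < 1) (Y : Fin n → ℝ)
    {S : Finset ℕ} (hS : S ∈ trees L) : 0 < ∑ T ∈ trees L, postWt n p Y T :=
  sum_pos (fun _ hT => postWt_pos hp hp1 Y (mem_trees.1 hT)) ⟨S, hS⟩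

theorem post_pos {L n : ℕ} {p : ℝ} (hp : 0 < p) (hp1 : p < 1) (Y : Fin n → ℝ)
    {S : Finset ℕ} (hS : S ∈ trees L) : 0 < post L n p Y S :=
  div_pos (postWt_pos hp hp1 Y (mem_trees.1 hS)) (sum_postWt_pos hp hp1 Y hS)

theorem sum_post {L n : ℕ} {p : ℝ} (hp : 0 < p) (hp1 : p < 1) (Y : Fin n → ℝ)
    {S : Finset ℕ} (hS : S ∈ trees L) : ∑ T ∈ trees L, post L n p Y T = 1 := by
  simp only [post]
  rw [← sum_div, div_self (sum_postWt_pos hp hp1 Y hS).ne']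

theorem prod_le_pow_symmDiff_mul_prod {w : ℕ → ℝ} {r : ℝ} (hr : 0 < r) {T V : Finset ℕ}
    (hw : ∀ j, 0 < w j) (h1 : ∀ j ∈ T \ V, w j ≤ r) (h2 : ∀ j ∈ V \ T, 1 ≤ r * w j) :
    ∏ j ∈ T, w j ≤ r ^ (symmDiff T V).card * ∏ j ∈ V, w j := by
  have hdisj : Disjoint (T \ V) (V \ T) := disjoint_sdiff_sdiff
  have hcard : (symmDiff T V).card = (T \ V).card + (V \ T).card := card_union_of_disjoint hdisj
  have hA : ∏ j ∈ T \ V, w j ≤ r ^ (T \ V).card := by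
    rw [← prod_const]
    exact prod_le_prod (fun j _ => (hw j).le) h1
  have hB : 1 ≤ r ^ (V \ T).card * ∏ j ∈ V \ T, w j := by
    rw [← prod_const, ← prod_mul_distrib]
    simpa using prod_le_prod (fun _ _ => zero_le_one) h2
  have hI : 0 < ∏ j ∈ T ∩ V, w j := prod_pos fun j _ => hw j
  rw [← prod_inter_mul_prod_sdiff T V w, ← prod_inter_mul_prod_sdiff V T w, inter_comm V T, hcard,
    pow_add]
  calc (∏ j ∈ T ∩ V, w j) * ∏ j ∈ T \ V, w j
      ≤ (∏ j ∈ T ∩ V, w j) * r ^ (T \ V).card * 1 := by rw [mul_one]; gcongr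
    _ ≤ (∏ j ∈ T ∩ V, w j) * r ^ (T \ V).card * (r ^ (V \ T).card * ∏ j ∈ V \ T, w j) := by
        gcongr
    _ = _ := by ring

/-- Trees are comparable to the trees they pass through when every redundant node has weight at
most `r` and every signal node has weight at least `1 / r`. -/
theorem post_le_pow_mul_post {L n : ℕ} {p r : ℝ} (hp : 0 < p) (hp1 : p < 1) (hr : 0 < r)
    {Y : Fin n → ℝ} {Sstar T V : Finset ℕ} (hT : T ∈ trees L) (hV : V ∈ trees L)
    (hnoise : ∀ j < 2 ^ L, j ∉ Sstar → nodeWt n p Y j ≤ r)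
    (hsignal : ∀ j ∈ Sstar, 1 ≤ r * nodeWt n p Y j)
    (h1 : Disjoint (T \ V) Sstar) (h2 : V \ T ⊆ Sstar) :
    post L n p Y T ≤ r ^ (symmDiff T V).card * post L n p Y V := by
  have hT' := mem_trees.1 hT
  have hV' := mem_trees.1 hV
  simp only [post]
  rw [← mul_div_assoc]
  refine div_le_div_of_nonneg_right ?_ (sum_postWt_pos hp hp1 Y hT).le
  rw [postWt_eq p Y hT', postWt_eq p Y hV', mul_left_comm]
  refine mul_le_mul_of_nonneg_left ?_ (by positivity)
  refine prod_le_pow_symmDiff_mul_prod hr (nodeWt_pos hp hp1 Y) ?_ fun j hj => hsignal j (h2 hj)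
  exact fun j hj => hnoise j (hT'.2.2 j (mem_sdiff.1 hj).1) (disjoint_left.1 h1 hj)

theorem sum_pow_card_symmDiff_le {L : ℕ} {r : ℝ} (hr : 0 ≤ r) {V : Finset ℕ} (hV : V ∈ trees L)
    {F : Finset (Finset ℕ)} (hF : F ⊆ trees L) :
    ∑ T ∈ F, r ^ (symmDiff T V).card ≤ (1 + r) ^ 2 ^ L := by
  have hinj : Set.InjOn (fun T => symmDiff T V) (F : Set (Finset ℕ)) :=
    (symmDiff_left_injective V).injOn
  have himg : F.image (fun T => symmDiff T V) ⊆ (range (2 ^ L)).powerset := by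
    intro D hD
    obtain ⟨T, hT, rfl⟩ := mem_image.1 hD
    rw [mem_powerset]
    intro j hj
    rw [mem_range]
    rcases mem_symmDiff.1 hj with h | h
    · exact (mem_trees.1 (hF hT)).2.2 j h.1
    · exact (mem_trees.1 hV).2.2 j h.1
  rw [← sum_image (f := fun D => r ^ D.card) hinj]
  refine (sum_le_sum_of_subset_of_nonneg himg fun _ _ _ => by positivity).trans_eq ?_
  have := sum_pow_mul_eq_add_pow r 1 (range (2 ^ L))
  simpa [add_comm r 1] using this

/-! ## Edge flows -/

theorem mul_lazy_mhTrans_ge {L : ℕ} {π₀ : Finset ℕ → ℝ} {q : Finset ℕ → Finset ℕ → ℝ}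
    {S S' : Finset ℕ} {a : ℝ} (ha : 0 < a) (hne : S' ≠ S) (hS : 0 < π₀ S) (hS' : 0 < π₀ S')
    (hq : a ≤ q S S') (hq' : a ≤ q S' S) :
    a / 2 * min (π₀ S) (π₀ S') ≤ π₀ S * lazy (mhTrans L π₀ q) S S' := by
  have hq0 : 0 < q S S' := ha.trans_le hq
  have e : π₀ S * lazy (mhTrans L π₀ q) S S' = min (π₀ S * q S S') (π₀ S' * q S' S) / 2 := by
    simp only [lazy, mhTrans, if_neg hne, add_zero]
    calc _ = (π₀ S * q S S') * min 1 (π₀ S' * q S' S / (π₀ S * q S S')) / 2 := by ring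
      _ = _ := by
        rw [mul_min_of_nonneg _ _ (by positivity), mul_one, mul_div_cancel₀ _ (by positivity)]
  rw [e, div_mul_eq_mul_div]
  refine div_le_div_of_nonneg_right ?_ (by norm_num)
  rw [mul_min_of_nonneg _ _ ha.le, mul_comm a, mul_comm a]
  exact min_le_min (by gcongr) (by gcongr)

/-- The flow along an edge of the canonical path ensemble in either direction is at least
`2 ^ (-(L + 1))` times the posterior mass of its tail. -/
theorem edge_flow_ge {L n : ℕ} {p r : ℝ} (hp : 0 < p) (hp1 : p < 1) (hr : 0 < r) (hr1 : r ≤ 1)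
    {Y : Fin n → ℝ} {Sstar V : Finset ℕ} (hV : V ∈ trees L) (hV' : gMap Sstar V ∈ trees L)
    (hne : V ≠ gMap Sstar V)
    (hnoise : ∀ j < 2 ^ L, j ∉ Sstar → nodeWt n p Y j ≤ r)
    (hsignal : ∀ j ∈ Sstar, 1 ≤ r * nodeWt n p Y j) :
    post L n p Y V / 2 ^ (L + 1) ≤
        post L n p Y V * lazy (mhTrans L (post L n p Y) (bcartProp L)) V (gMap Sstar V) ∧
      post L n p Y V / 2 ^ (L + 1) ≤ post L n p Y (gMap Sstar V) *
        lazy (mhTrans L (post L n p Y) (bcartProp L)) (gMap Sstar V) V := by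
  have hq : ((2 : ℝ) ^ L)⁻¹ ≤ bcartProp L V (gMap Sstar V) ∧
      ((2 : ℝ) ^ L)⁻¹ ≤ bcartProp L (gMap Sstar V) V := by
    rcases gMap_cases Sstar V with h | ⟨j, hj, h⟩ | ⟨j, hj, h⟩
    · exact absurd h.symm hne
    · rw [h] at hV' ⊢
      have hins : insert j (V.erase j) = V := insert_erase (mem_sdiff.1 hj).1
      have := bcartProp_ge (mem_trees.1 hV') (hins.symm ▸ mem_trees.1 hV) (notMem_erase j V)
      rw [hins] at this
      exact this.symm
    · rw [h] at hV' ⊢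
      exact bcartProp_ge (mem_trees.1 hV) (mem_trees.1 hV') (mem_sdiff.1 hj).2
  have hstep := iterate_gMap_sdiff Sstar V 1
  rw [Function.iterate_one] at hstep
  have hpV := post_pos hp hp1 Y hV
  have hpV' := post_pos hp hp1 Y hV'
  have hle : post L n p Y V ≤ post L n p Y (gMap Sstar V) :=
    (post_le_pow_mul_post hp hp1 hr hV hV' hnoise hsignal hstep.1 hstep.2).trans
      (mul_le_of_le_one_left hpV'.le (pow_le_one₀ hr.le hr1))
  have ha : (0 : ℝ) < ((2 : ℝ) ^ L)⁻¹ := by positivity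
  have e : post L n p Y V / 2 ^ (L + 1) = ((2 : ℝ) ^ L)⁻¹ / 2 * post L n p Y V := by
    rw [pow_succ]
    field_simp
  have g1 := mul_lazy_mhTrans_ge (L := L) ha hne.symm hpV hpV' hq.1 hq.2
  have g2 := mul_lazy_mhTrans_ge (L := L) ha hne hpV' hpV hq.2 hq.1
  rw [min_eq_left hle] at g1
  rw [min_eq_right hle] at g2
  rw [e]
  exact ⟨g1, g2⟩

/-- A canonical edge cannot be traversed in both directions. -/
theorem gMap_ne_of_gMap_eq {Sstar U U' : Finset ℕ} (hne : U ≠ U') (h : U' = gMap Sstar U) :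
    U ≠ gMap Sstar U' := by
  intro h'
  have a := iterate_gMap_sdiff Sstar U 1
  have b := iterate_gMap_sdiff Sstar U' 1
  rw [Function.iterate_one] at a b
  rw [← h] at a
  rw [← h'] at b
  have e1 : U \ U' = ∅ := by
    rw [← disjoint_self_iff_empty]
    exact a.1.mono_right b.2
  have e2 : U' \ U = ∅ := by
    rw [← disjoint_self_iff_empty]
    exact b.1.mono_right a.2
  rw [sdiff_eq_empty_iff_subset] at e1 e2
  exact hne (e1.antisymm e2)

/-- The posterior mass of the trees whose canonical path visits `V` is at most
`(1 + r) ^ 2 ^ L` times that of `V`. -/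
theorem sum_post_visiting_le {L n : ℕ} {p r : ℝ} (hp : 0 < p) (hp1 : p < 1) (hr : 0 < r)
    {Y : Fin n → ℝ} {Sstar V : Finset ℕ} (hV : V ∈ trees L)
    (hnoise : ∀ j < 2 ^ L, j ∉ Sstar → nodeWt n p Y j ≤ r)
    (hsignal : ∀ j ∈ Sstar, 1 ≤ r * nodeWt n p Y j)
    {F : Finset (Finset ℕ)} (hF : F ⊆ trees L) (hvisit : ∀ T ∈ F, ∃ t, (gMap Sstar)^[t] T = V) :
    ∑ T ∈ F, post L n p Y T ≤ (1 + r) ^ 2 ^ L * post L n p Y V := by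
  calc ∑ T ∈ F, post L n p Y T
      ≤ ∑ T ∈ F, r ^ (symmDiff T V).card * post L n p Y V := by
        refine sum_le_sum fun T hT => ?_
        obtain ⟨t, ht⟩ := hvisit T hT
        have := iterate_gMap_sdiff Sstar T t
        rw [ht] at this
        exact post_le_pow_mul_post hp hp1 hr (hF hT) hV hnoise hsignal this.1 this.2
    _ ≤ _ := by
        rw [← sum_mul]
        exact mul_le_mul_of_nonneg_right (sum_pow_card_symmDiff_le hr.le hV hF)
          (post_pos hp hp1 Y hV).le

theorem congestion_le {L n : ℕ} {p r : ℝ} (hp : 0 < p) (hp1 : p < 1) (hr : 0 < r) (hr1 : r ≤ 1)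
    {Y : Fin n → ℝ} {Sstar U U' : Finset ℕ} (hU : U ∈ trees L) (hU' : U' ∈ trees L)
    (hnoise : ∀ j < 2 ^ L, j ∉ Sstar → nodeWt n p Y j ≤ r)
    (hsignal : ∀ j ∈ Sstar, 1 ≤ r * nodeWt n p Y j)
    (hpath : ∃ T ∈ trees L, ∃ T' ∈ trees L, onPath L (gMap Sstar) (U, U') T T') :
    (∑ e ∈ (trees L ×ˢ trees L).filter (fun e => onPath L (gMap Sstar) (U, U') e.1 e.2),
        post L n p Y e.1 * post L n p Y e.2) /
        (post L n p Y U * lazy (mhTrans L (post L n p Y) (bcartProp L)) U U') ≤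
      2 ^ (L + 1) * (1 + r) ^ 2 ^ L := by
  classical
  have finish : ∀ V ∈ trees L, ∀ Q : ℝ, post L n p Y V / 2 ^ (L + 1) ≤ Q →
      ∀ X : ℝ, X ≤ (1 + r) ^ 2 ^ L * post L n p Y V →
      X / Q ≤ 2 ^ (L + 1) * (1 + r) ^ 2 ^ L := by
    intro V hV Q hQ X hX
    have hQ0 : 0 < Q := lt_of_lt_of_le (div_pos (post_pos hp hp1 Y hV) (by positivity)) hQ
    rw [div_le_iff₀ hQ0]
    rw [div_le_iff₀ (by positivity)] at hQ
    calc X ≤ (1 + r) ^ 2 ^ L * post L n p Y V := hX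
      _ ≤ (1 + r) ^ 2 ^ L * (Q * 2 ^ (L + 1)) := by gcongr
      _ = _ := by ring
  have hnn : ∀ F ⊆ trees L, ∀ T ∈ F, 0 ≤ post L n p Y T :=
    fun F hF T hT => (post_pos hp hp1 Y (hF hT)).le
  have prodBound : ∀ F ⊆ trees L, ∀ F' ⊆ trees L,
      (trees L ×ˢ trees L).filter (fun e => onPath L (gMap Sstar) (U, U') e.1 e.2) ⊆ F ×ˢ F' →
      ∑ e ∈ (trees L ×ˢ trees L).filter (fun e => onPath L (gMap Sstar) (U, U') e.1 e.2),
        post L n p Y e.1 * post L n p Y e.2 ≤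
      (∑ T ∈ F, post L n p Y T) * ∑ T ∈ F', post L n p Y T := by
    intro F hF F' hF' hsub
    rw [sum_mul_sum, ← sum_product']
    refine sum_le_sum_of_subset_of_nonneg hsub fun e he _ => ?_
    rw [mem_product] at he
    exact mul_nonneg (hnn F hF _ he.1) (hnn F' hF' _ he.2)
  have visiting : ∀ V ∈ trees L, ∑ T ∈ (trees L).filter (fun T => ∃ t, (gMap Sstar)^[t] T = V),
      post L n p Y T ≤ (1 + r) ^ 2 ^ L * post L n p Y V := fun V hV =>
    sum_post_visiting_le hp hp1 hr hV hnoise hsignal (filter_subset _ _)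
      fun T hT => (mem_filter.1 hT).2
  obtain ⟨T₀, -, T₀', -, ⟨h, -⟩ | ⟨h, -⟩⟩ := hpath
  · obtain ⟨-, hg, hne⟩ := of_mem_pathEdges h
    refine finish U hU _ ?_ _ ?_
    · subst hg
      exact (edge_flow_ge hp hp1 hr hr1 hU hU' hne hnoise hsignal).1
    · refine (prodBound _ (filter_subset (fun T => ∃ t, (gMap Sstar)^[t] T = U) _) _ subset_rfl
        ?_).trans (by rw [sum_post hp hp1 Y hU, mul_one]; exact visiting U hU)
      intro e he
      rw [mem_filter, mem_product] at he
      obtain ⟨⟨he1, he2⟩, ⟨h', -⟩ | ⟨h', -⟩⟩ := he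
      · exact mem_product.2 ⟨mem_filter.2 ⟨he1, (of_mem_pathEdges h').1⟩, he2⟩
      · exact absurd (of_mem_pathEdges h').2.1 (gMap_ne_of_gMap_eq hne hg)
  · rw [Prod.swap_prod_mk] at h
    obtain ⟨-, hg, hne⟩ := of_mem_pathEdges h
    refine finish U' hU' _ ?_ _ ?_
    · subst hg
      exact (edge_flow_ge hp hp1 hr hr1 hU' hU hne hnoise hsignal).2
    · refine (prodBound _ subset_rfl _ (filter_subset (fun T => ∃ t, (gMap Sstar)^[t] T = U') _)
        ?_).trans (by rw [sum_post hp hp1 Y hU, one_mul]; exact visiting U' hU')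
      intro e he
      rw [mem_filter, mem_product] at he
      obtain ⟨⟨he1, he2⟩, ⟨h', -⟩ | ⟨h', -⟩⟩ := he
      · exact absurd (of_mem_pathEdges h').2.1 (gMap_ne_of_gMap_eq hne hg)
      · exact mem_product.2 ⟨he1, mem_filter.2 ⟨he2, (of_mem_pathEdges h').1⟩⟩

/-! ## Node weights on the noise event -/

theorem nodeWt_le_of_noise {n : ℕ} {c : ℝ} (hn : 1 ≤ n) {Y : Fin n → ℝ} {j : ℕ}
    (hD : |colDot n Y j| ≤ 2 * √(n * Real.log n)) :
    nodeWt n (splitP n c) Y j ≤ (n : ℝ) ^ (3 / 2 - c) := by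
  have hn1 : (1 : ℝ) ≤ n := by exact_mod_cast hn
  have hn0 : (0 : ℝ) < n := by linarith
  have hlog : 0 ≤ Real.log n := Real.log_nonneg hn1
  have hD2 : colDot n Y j ^ 2 ≤ 4 * (n * Real.log n) := by
    rw [← sq_abs]
    calc |colDot n Y j| ^ 2 ≤ (2 * √(n * Real.log n)) ^ 2 := by gcongr
      _ = 4 * (n * Real.log n) := by rw [mul_pow, Real.sq_sqrt (by positivity)]; norm_num
  have hexp : Real.exp (colDot n Y j ^ 2 / (2 * ((n : ℝ) + 1))) ≤ (n : ℝ) ^ (2 : ℝ) := by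
    rw [Real.rpow_def_of_pos hn0]
    refine Real.exp_le_exp.2 ?_
    rw [div_le_iff₀ (by positivity)]
    nlinarith
  have hp0 : 0 < splitP n c := Real.rpow_pos_of_pos hn0 _
  have hrt : (1 + n : ℝ) ^ (-(1 : ℝ) / 2) ≤ (n : ℝ) ^ (-(1 : ℝ) / 2) :=
    Real.rpow_le_rpow_of_nonpos hn0 (by linarith) (by norm_num)
  have hpp : splitP n c * (1 - splitP n c) ≤ splitP n c := by nlinarith
  calc nodeWt n (splitP n c) Y j
      ≤ splitP n c * (n : ℝ) ^ (-(1 : ℝ) / 2) * (n : ℝ) ^ (2 : ℝ) := by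
        unfold nodeWt
        gcongr
    _ = (n : ℝ) ^ (3 / 2 - c) := by
        rw [splitP, ← Real.rpow_add hn0, ← Real.rpow_add hn0]
        congr 1
        ring

theorem one_le_mul_nodeWt_of_signal {n : ℕ} {c : ℝ} (hc : 1 ≤ c) (hn : 0 < n)
    (hlog : 2 * c + 1 ≤ Real.log n) {Y : Fin n → ℝ} {j : ℕ}
    (hD : 2 * √n * Real.log n ≤ |colDot n Y j|) :
    1 ≤ (n : ℝ) ^ (3 / 2 - c) * nodeWt n (splitP n c) Y j := by
  have hn0 : (0 : ℝ) < n := by exact_mod_cast hn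
  have hn4 : (4 : ℝ) ≤ n := by
    have := Real.add_one_le_exp (Real.log n)
    rw [Real.exp_log hn0] at this
    linarith
  have hl0 : 0 ≤ Real.log n := by linarith
  have hD2 : 4 * n * Real.log n ^ 2 ≤ colDot n Y j ^ 2 := by
    rw [← sq_abs (colDot n Y j)]
    calc 4 * n * Real.log n ^ 2 = (2 * √n * Real.log n) ^ 2 := by
          rw [mul_pow, mul_pow, Real.sq_sqrt hn0.le]; norm_num
      _ ≤ |colDot n Y j| ^ 2 := by gcongr
  have hexp : (n : ℝ) ^ Real.log n ≤ Real.exp (colDot n Y j ^ 2 / (2 * ((n : ℝ) + 1))) := by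
    rw [Real.rpow_def_of_pos hn0]
    refine Real.exp_le_exp.2 ?_
    rw [le_div_iff₀ (by positivity)]
    nlinarith [mul_nonneg hl0 hl0]
  have hp0 : 0 < splitP n c := Real.rpow_pos_of_pos hn0 _
  have hp1 : splitP n c ≤ 1 / 2 := by
    calc splitP n c ≤ (n : ℝ) ^ (-1 : ℝ) :=
          Real.rpow_le_rpow_of_exponent_le (by linarith) (by linarith)
      _ ≤ 1 / 2 := by
          rw [Real.rpow_neg_one, inv_le_comm₀ hn0 (by norm_num)]
          linarith
  have hrt : (1 / 2 : ℝ) * (n : ℝ)⁻¹ ≤ (1 + n : ℝ) ^ (-(1 : ℝ) / 2) := by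
    calc (1 / 2 : ℝ) * (n : ℝ)⁻¹ = (2 * n : ℝ)⁻¹ := by rw [mul_inv]; norm_num
      _ ≤ (1 + n : ℝ)⁻¹ := inv_anti₀ (by positivity) (by linarith)
      _ = (1 + n : ℝ) ^ (-1 : ℝ) := (Real.rpow_neg_one _).symm
      _ ≤ _ := Real.rpow_le_rpow_of_exponent_le (by linarith) (by norm_num)
  have hcst : (n : ℝ) ^ (-2 : ℝ) ≤ 1 / 2 * (1 / 2 * (n : ℝ)⁻¹) := by
    rw [show (-2 : ℝ) = -1 + -1 by norm_num, Real.rpow_add hn0, Real.rpow_neg_one, ← mul_assoc]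
    refine mul_le_mul_of_nonneg_right ?_ (by positivity)
    rw [inv_le_comm₀ hn0 (by norm_num)]
    linarith
  calc (1 : ℝ) ≤ (n : ℝ) ^ ((3 / 2 - c) + (-c + -2 + Real.log n)) :=
        Real.one_le_rpow (by linarith) (by linarith)
    _ = (n : ℝ) ^ (3 / 2 - c) * (splitP n c * (n : ℝ) ^ (-2 : ℝ) * (n : ℝ) ^ Real.log n) := by
        rw [splitP, Real.rpow_add hn0, Real.rpow_add hn0 (-c + -2), Real.rpow_add hn0 (-c)]
    _ ≤ (n : ℝ) ^ (3 / 2 - c) * (splitP n c * (1 / 2 * (1 / 2 * (n : ℝ)⁻¹)) *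
          Real.exp (colDot n Y j ^ 2 / (2 * ((n : ℝ) + 1)))) := by gcongr
    _ = (n : ℝ) ^ (3 / 2 - c) * (splitP n c * (1 / 2) * (1 / 2 * (n : ℝ)⁻¹) *
          Real.exp (colDot n Y j ^ 2 / (2 * ((n : ℝ) + 1)))) := by ring
    _ ≤ (n : ℝ) ^ (3 / 2 - c) * nodeWt n (splitP n c) Y j := by
        have hp2 : 1 / 2 ≤ 1 - splitP n c := by linarith
        have hp3 : 0 ≤ 1 - splitP n c := by linarith
        unfold nodeWt
        gcongr

theorem abs_signal_add_noise_ge {x b ξ A : ℝ} (hx : 0 < x) (hlog : 1 ≤ Real.log x) (hA : 4 ≤ A)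
    (hb : A * Real.log x / √x < |b|) (hξ : |ξ| ≤ 2 * √(x * Real.log x)) :
    2 * √x * Real.log x ≤ |x * b + ξ| := by
  have hs : 0 < √x := Real.sqrt_pos.2 hx
  have hss : √x * √x = x := Real.mul_self_sqrt hx.le
  have h1 : 4 * √x * Real.log x ≤ x * |b| := by
    rw [div_lt_iff₀ hs] at hb
    calc 4 * √x * Real.log x = √x * (4 * Real.log x) := by ring
      _ ≤ √x * (|b| * √x) := by
        have : 4 * Real.log x ≤ A * Real.log x := by gcongr
        exact mul_le_mul_of_nonneg_left (by linarith) hs.le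
      _ = (√x * √x) * |b| := by ring
      _ = x * |b| := by rw [hss]
  have h2 : √(x * Real.log x) ≤ √x * Real.log x := by
    rw [Real.sqrt_mul hx.le]
    gcongr
    exact Real.sqrt_le_iff.2 ⟨by linarith, by nlinarith⟩
  have h3 : |x * b| = x * |b| := by rw [abs_mul, abs_of_pos hx]
  have h4 := abs_sub_abs_le_abs_sub (x * b) (-ξ)
  rw [abs_neg, sub_neg_eq_add, h3] at h4
  nlinarith

theorem eventually_congestion_constants {c δ : ℝ} (hc : 5 / 2 < c) (hδ : 0 < δ) :
    ∃ N : ℕ, ∀ n ≥ N, 2 * c + 1 ≤ Real.log n ∧ Real.exp ((n : ℝ) ^ (5 / 2 - c)) ≤ 1 + δ := by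
  rw [← Filter.eventually_atTop]
  have h1 : Filter.Tendsto (fun n : ℕ => Real.log n) Filter.atTop Filter.atTop :=
    Real.tendsto_log_atTop.comp tendsto_natCast_atTop_atTop
  have h2 : Filter.Tendsto (fun n : ℕ => Real.exp ((n : ℝ) ^ (5 / 2 - c))) Filter.atTop
      (nhds 1) := by
    have := (tendsto_rpow_neg_atTop (y := c - 5 / 2) (by linarith)).comp
      (tendsto_natCast_atTop_atTop (R := ℝ))
    have := (Real.continuous_exp.tendsto 0).comp this
    simpa [Function.comp_def, neg_sub] using this
  exact (h1.eventually_ge_atTop _).and (h2.eventually_le_const (by linarith))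

/-- **Lemma (Congestion bound for the Bayesian CART canonical path ensemble).**
Assume the model and the Bayesian CART prior with `p_{lk} = n^{-c}`, `c > 5/2`, and
Assumption 1(a) with a sufficiently large `A`.  For every `δ > 0` there is an `N`
such that for all `n ≥ N`, with probability at least `1 − 4/n` over `ε ~ N(0, I_n)`,
the congestion parameter of the canonical path ensemble satisfies
`ρ(𝓔) ≤ 2^{L+1}(1 + δ)`: for every edge `(U, U')` lying on some canonical path,
`Q(U,U')^{-1} Σ_{(𝒯,𝒯'): (U,U') ∈ T_{𝒯,𝒯'}} Π(𝒯|Y)Π(𝒯'|Y) ≤ 2^{L+1}(1+δ)`. -/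
theorem bcart_congestion_bound (c : ℝ) (hc : 5 / 2 < c) (δ : ℝ) (hδ : 0 < δ) :
    ∃ (A₀ : ℝ) (N : ℕ), 0 < A₀ ∧
      ∀ (Lmax L n : ℕ), n = 2 ^ (Lmax + 1) → L ≤ Lmax → N ≤ n →
      ∀ A ≥ A₀, ∀ (C : ℝ) (β : ℕ → ℝ) (B Sstar : Finset ℕ),
      Assumption1 L n A C β B Sstar → Sstar = B →
      ENNReal.ofReal (1 - 4 / n) ≤
        gauss n {ε |
          ∀ U ∈ trees L, ∀ U' ∈ trees L,
            (∃ T ∈ trees L, ∃ T' ∈ trees L, onPath L (gMap Sstar) (U, U') T T') →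
            (∑ e ∈ (trees L ×ˢ trees L).filter
                  (fun e => onPath L (gMap Sstar) (U, U') e.1 e.2),
                post L n (splitP n c) (Yvec n β B ε) e.1 *
                  post L n (splitP n c) (Yvec n β B ε) e.2) /
                (post L n (splitP n c) (Yvec n β B ε) U *
                  lazy (bcartP L n c (Yvec n β B ε)) U U')
              ≤ 2 ^ (L + 1) * (1 + δ)} := by
  obtain ⟨N, hN⟩ := eventually_congestion_constants hc hδ
  refine ⟨4, max N 1, by norm_num, ?_⟩
  rintro Lmax L n rfl hL hNn A hA C β _ S hass rfl
  set M := Lmax + 1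
  have hLM : L < M := Nat.lt_succ_of_le hL
  obtain ⟨hlog, hexp⟩ := hN _ (le_of_max_le_left hNn)
  have hnn : 1 ≤ 2 ^ M := Nat.one_le_two_pow
  refine (gauss_abs_colDot_bound hLM).trans (measure_mono fun ε hε => ?_)
  rw [Set.mem_ofPred_eq] at hε ⊢
  have hcast : ((2 ^ M : ℕ) : ℝ) = 2 ^ M := by push_cast; rfl
  have hLpow : 2 ^ L ≤ 2 ^ M := Nat.pow_le_pow_right (by norm_num) hLM.le
  have hY : ∀ j < 2 ^ L, colDot (2 ^ M) (Yvec (2 ^ M) β S ε) j =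
      (if j ∈ S then ((2 ^ M : ℕ) : ℝ) * β j else 0) + colDot (2 ^ M) ε j := fun j hj => by
    rw [colDot_Yvec (hj.trans_le hLpow) (fun k hk => (hass.B_depth k hk).trans_le hLpow), hcast]
  set n := 2 ^ M
  have hn0 : (0 : ℝ) < n := by exact_mod_cast hnn
  have hn1 : (1 : ℝ) < n := (Real.log_pos_iff hn0.le).1 (by linarith)
  have hp0 : 0 < splitP n c := Real.rpow_pos_of_pos hn0 _
  have hp1 : splitP n c < 1 := Real.rpow_lt_one_of_one_lt_of_neg hn1 (by linarith)
  have hr0 : 0 < (n : ℝ) ^ (3 / 2 - c) := Real.rpow_pos_of_pos hn0 _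
  have hr1 : (n : ℝ) ^ (3 / 2 - c) ≤ 1 := Real.rpow_le_one_of_one_le_of_nonpos hn1.le (by linarith)
  have hr : (1 + (n : ℝ) ^ (3 / 2 - c)) ^ 2 ^ L ≤ 1 + δ := by
    calc (1 + (n : ℝ) ^ (3 / 2 - c)) ^ 2 ^ L ≤ (1 + (n : ℝ) ^ (3 / 2 - c)) ^ n :=
          pow_le_pow_right₀ (by linarith) hLpow
      _ ≤ Real.exp ((n : ℝ) ^ (3 / 2 - c)) ^ n := by
          gcongr
          rw [add_comm]
          exact Real.add_one_le_exp _
      _ = Real.exp ((n : ℝ) ^ (5 / 2 - c)) := by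
          rw [← Real.exp_nat_mul]
          nth_rewrite 1 [← Real.rpow_one (n : ℝ)]
          rw [← Real.rpow_add hn0]
          congr 2
          ring
      _ ≤ 1 + δ := hexp
  intro U hU U' hU' hpath
  refine (congestion_le hp0 hp1 hr0 hr1 hU hU' ?_ ?_ hpath).trans (by gcongr)
  · intro j hj hjS
    refine nodeWt_le_of_noise hnn ?_
    rw [hY j hj, if_neg hjS, zero_add]
    exact (hε j hj).le
  · intro j hjS
    have hj := hass.B_depth j hjS
    refine one_le_mul_nodeWt_of_signal (by linarith) hnn hlog ?_
    rw [hY j hj, if_pos hjS]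
    exact abs_signal_add_noise_ge hn0 (by linarith) hA (hass.signal_low j hjS) (hε j hj).le

end BayesCART
end
end
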